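/- arXiv:1502.04898 — 10 statements merged into one kernel-verified Lean document; each statement's English description precedes it below -/
import Mathlib

section
/- (Syntactic Morphism Theorem) Let T be a monad on the category of I-sorted sets. Call a T-algebra B finitary if for every sort σ and every w ∈ (T B)(σ) there is a sorted subset B₀ ⊆ B with only finitely many elements in total such that w lies in the image of (T incl)(σ), where incl : B₀ → B is the inclusion. Let f : A → C be a colouring of a T-algebra A which is recognised by some T-morphism h : A → B into a finitary T-algebra B (i.e. f = f' ∘ h for some sorted function f'). Then there exists a surjective T-morphism synt_f : A → A_f into a T-algebra A_f which recognises f and which factors through every surjective T-morphism recognising f: for every surjective T-morphism h' : A → B' with f = f'' ∘ h' for some f'', there exists a (necessarily unique, and automatically a T-morphism) sorted function g : B' → A_f with g ∘ h' = synt_f. Moreover synt_f is unique up to isomorphism: if s₁ : A → A₁ and s₂ : A → A₂ both have these properties then there is a bijective T-morphism i : A₁ → A₂ with i ∘ s₁ = s₂. -/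
universe u

/-- A monad on the category of `I`-sorted sets. -/
structure SortedMonad (I : Type u) : Type (u + 1) where
  T : (I → Type u) → I → Type u
  map : {X Y : I → Type u} → (∀ i, X i → Y i) → ∀ i, T X i → T Y i
  unit : {X : I → Type u} → ∀ i, X i → T X i
  mult : {X : I → Type u} → ∀ i, T (T X) i → T X i
  map_id : ∀ {X : I → Type u} (i : I) (w : T X i), map (fun _ x => x) i w = w
  map_comp : ∀ {X Y Z : I → Type u} (g : ∀ i, Y i → Z i) (f : ∀ i, X i → Y i) (i : I)
      (w : T X i), map (fun i => g i ∘ f i) i w = map g i (map f i w)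
  unit_nat : ∀ {X Y : I → Type u} (f : ∀ i, X i → Y i) (i : I) (x : X i),
      map f i (unit i x) = unit i (f i x)
  mult_nat : ∀ {X Y : I → Type u} (f : ∀ i, X i → Y i) (i : I) (w : T (T X) i),
      map f i (mult i w) = mult i (map (map f) i w)
  mult_unit : ∀ {X : I → Type u} (i : I) (w : T X i), mult i (unit i w) = w
  mult_map_unit : ∀ {X : I → Type u} (i : I) (w : T X i), mult i (map unit i w) = w
  mult_assoc : ∀ {X : I → Type u} (i : I) (w : T (T (T X)) i),
      mult i (mult i w) = mult i (map mult i w)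

/-- An Eilenberg–Moore algebra for a monad on sorted sets. -/
structure SortedMonad.Alg {I : Type u} (M : SortedMonad I) : Type (u + 1) where
  carrier : I → Type u
  mul : ∀ i, M.T carrier i → carrier i
  mul_unit : ∀ i a, mul i (M.unit i a) = a
  mul_assoc : ∀ i w, mul i (M.mult i w) = mul i (M.map mul i w)

namespace SortedMonad

variable {I : Type u} (M : SortedMonad I)

/-- A morphism of Eilenberg–Moore algebras. -/
def IsHom (A B : M.Alg) (h : ∀ i, A.carrier i → B.carrier i) : Prop :=
  ∀ i w, h i (A.mul i w) = B.mul i (M.map h i w)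

/-- A colouring `f` is recognised by `h` if it factors through `h`. -/
def Recognises (A B : M.Alg) (h : ∀ i, A.carrier i → B.carrier i)
    {C : I → Type u} (f : ∀ i, A.carrier i → C i) : Prop :=
  ∃ f' : ∀ i, B.carrier i → C i, ∀ i a, f i a = f' i (h i a)


/-- A T-algebra is finitary if every structure over its universe already lives over a
sorted subset with finitely many elements in total. -/
def Finitary (B : M.Alg) : Prop :=
  ∀ (σ : I) (w : M.T B.carrier σ),
    ∃ S : ∀ i, Set (B.carrier i), Finite ((i : I) × ↥(S i)) ∧
      ∃ w₀ : M.T (fun i => ↥(S i)) σ,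
        M.map (fun i (x : ↥(S i)) => (x : B.carrier i)) σ w₀ = w

/-- `s : A → Af` is a syntactic morphism of the colouring `f`: a surjective T-morphism
recognising `f` that factors through every surjective T-morphism recognising `f`. -/
def IsSyntacticMorphism (A : M.Alg) {C : I → Type u} (f : ∀ i, A.carrier i → C i)
    (Af : M.Alg) (s : ∀ i, A.carrier i → Af.carrier i) : Prop :=
  M.IsHom A Af s ∧ (∀ i, Function.Surjective (s i)) ∧ M.Recognises A Af s f ∧
    ∀ (B' : M.Alg) (h' : ∀ i, A.carrier i → B'.carrier i),
      M.IsHom A B' h' → (∀ i, Function.Surjective (h' i)) → M.Recognises A B' h' f →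
        ∃ g : ∀ i, B'.carrier i → Af.carrier i,
          M.IsHom B' Af g ∧ ∀ i a, g i (h' i a) = s i a

end SortedMonad

namespace SortedMonad

variable {I : Type u} {M : SortedMonad I}

theorem map_map {X Y Z : I → Type u} (g : ∀ i, Y i → Z i) (f : ∀ i, X i → Y i) (i : I)
    (w : M.T X i) : M.map g i (M.map f i w) = M.map (fun i x => g i (f i x)) i w :=
  (M.map_comp g f i w).symm

theorem map_congr {X Y : I → Type u} {f g : ∀ i, X i → Y i} (hfg : ∀ i x, f i x = g i x)
    (i : I) (w : M.T X i) : M.map f i w = M.map g i w := by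
  have : f = g := by funext i x; exact hfg i x
  rw [this]

theorem map_eq_self {X : I → Type u} {f : ∀ i, X i → X i} (hf : ∀ i x, f i x = x)
    (i : I) (w : M.T X i) : M.map f i w = w :=
  (map_congr hf i w).trans (M.map_id i w)

theorem exists_map_eq {X Y : I → Type u} {f : ∀ i, X i → Y i}
    (hf : ∀ i, Function.Surjective (f i)) (i : I) (w : M.T Y i) :
    ∃ v, M.map f i v = w :=
  ⟨M.map (fun i => Function.surjInv (hf i)) i w, by
    rw [map_map]; exact map_eq_self (fun i x => Function.surjInv_eq (hf i) x) i w⟩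

/-- A sorted function out of the codomain of a surjective morphism is a morphism as soon as
its composite with the surjection is one. -/
theorem IsHom.of_comp_surjective {A B D : M.Alg} {h : ∀ i, A.carrier i → B.carrier i}
    {s : ∀ i, A.carrier i → D.carrier i} {g : ∀ i, B.carrier i → D.carrier i}
    (hh : M.IsHom A B h) (hsurj : ∀ i, Function.Surjective (h i)) (hs : M.IsHom A D s)
    (hg : ∀ i a, g i (h i a) = s i a) : M.IsHom B D g := by
  intro i w
  obtain ⟨v, rfl⟩ := exists_map_eq hsurj i w
  rw [← hh, hg, hs, map_map, map_congr hg]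

/-- Syntactic morphisms of the same colouring are isomorphic. -/
theorem IsSyntacticMorphism.exists_iso {A : M.Alg} {C : I → Type u}
    {f : ∀ i, A.carrier i → C i} {A₁ A₂ : M.Alg} {s₁ : ∀ i, A.carrier i → A₁.carrier i}
    {s₂ : ∀ i, A.carrier i → A₂.carrier i} (h₁ : M.IsSyntacticMorphism A f A₁ s₁)
    (h₂ : M.IsSyntacticMorphism A f A₂ s₂) :
    ∃ iso : ∀ i, A₁.carrier i → A₂.carrier i,
      M.IsHom A₁ A₂ iso ∧ (∀ i, Function.Bijective (iso i)) ∧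
        ∀ i a, iso i (s₁ i a) = s₂ i a := by
  obtain ⟨hom₁, surj₁, rec₁, univ₁⟩ := h₁
  obtain ⟨hom₂, surj₂, rec₂, univ₂⟩ := h₂
  obtain ⟨g, hg, hgs⟩ := univ₂ A₁ s₁ hom₁ surj₁ rec₁
  obtain ⟨k, -, hks⟩ := univ₁ A₂ s₂ hom₂ surj₂ rec₂
  refine ⟨g, hg, fun i => ⟨?_, ?_⟩, hgs⟩
  · refine Function.LeftInverse.injective (g := k i) fun x => ?_
    obtain ⟨a, rfl⟩ := surj₁ i x
    rw [hgs, hks]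
  · intro y
    obtain ⟨a, rfl⟩ := surj₂ i y
    exact ⟨s₁ i a, hgs i a⟩

/-- The set of variables of a unary polynomial: elements of `X` as constants, together with
one extra variable of sort `σ`. -/
abbrev WithVar (X : I → Type u) (σ : I) (i : I) : Type u := X i ⊕ PLift (i = σ)

/-- Substitute `a` for the extra variable. -/
def plug {X : I → Type u} {σ : I} (a : X σ) (i : I) : WithVar X σ i → X i :=
  Sum.elim id fun h => h.down ▸ a

/-- The value of the unary polynomial `p` at `a`. -/
def polyEval (A : M.Alg) {σ τ : I} (p : M.T (WithVar A.carrier σ) τ) (a : A.carrier σ) :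
    A.carrier τ :=
  A.mul τ (M.map (plug a) τ p)

/-- Unary polynomials are closed under composition. -/
theorem exists_polyEval_comp (A : M.Alg) {σ τ υ : I} (p : M.T (WithVar A.carrier σ) τ)
    (q : M.T (WithVar A.carrier τ) υ) :
    ∃ r : M.T (WithVar A.carrier σ) υ, ∀ a, polyEval A r a = polyEval A q (polyEval A p a) := by
  let k : ∀ i, WithVar A.carrier τ i → M.T (WithVar A.carrier σ) i := fun i =>
    Sum.elim (fun a => M.unit i (Sum.inl a)) fun h => h.down ▸ p
  refine ⟨M.mult υ (M.map k υ q), fun a => ?_⟩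
  unfold polyEval
  rw [M.mult_nat, A.mul_assoc, map_map, map_map]
  congr 1
  refine map_congr (fun i x => ?_) υ q
  rcases x with x | ⟨⟨rfl⟩⟩
  · simp [k, plug, M.unit_nat, A.mul_unit]
  · simp [k, plug]

/-- Two elements are syntactically equivalent if no unary polynomial separates their
colours. -/
def syntSetoid (A : M.Alg) {C : I → Type u} (f : ∀ i, A.carrier i → C i) (σ : I) :
    Setoid (A.carrier σ) where
  r a b := ∀ (τ : I) (p : M.T (WithVar A.carrier σ) τ),
    f τ (polyEval A p a) = f τ (polyEval A p b)
  iseqv := ⟨fun _ _ _ => rfl, fun h τ p => (h τ p).symm, fun h k τ p => (h τ p).trans (k τ p)⟩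

section Syntactic

variable {A : M.Alg} {C : I → Type u} {f : ∀ i, A.carrier i → C i}

theorem colour_eq_of_syntSetoid {σ : I} {a b : A.carrier σ} (hab : syntSetoid A f σ a b) :
    f σ a = f σ b := by
  have := hab σ (M.unit σ (Sum.inr ⟨rfl⟩))
  simpa [polyEval, plug, M.unit_nat, A.mul_unit] using this

theorem syntSetoid_polyEval {σ τ : I} {a b : A.carrier σ} (hab : syntSetoid A f σ a b)
    (p : M.T (WithVar A.carrier σ) τ) :
    syntSetoid A f τ (polyEval A p a) (polyEval A p b) := by
  intro υ q
  obtain ⟨r, hr⟩ := exists_polyEval_comp A p q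
  rw [← hr, ← hr]
  exact hab υ r

theorem syntSetoid_of_hom_eq {B : M.Alg} {h : ∀ i, A.carrier i → B.carrier i}
    (hhom : M.IsHom A B h) (hrec : M.Recognises A B h f) {σ : I} {a b : A.carrier σ}
    (hab : h σ a = h σ b) : syntSetoid A f σ a b := by
  intro τ p
  obtain ⟨f', hf'⟩ := hrec
  rw [hf', hf']
  congr 1
  unfold polyEval
  rw [hhom, hhom, map_map, map_map]
  congr 1
  refine map_congr (fun i x => ?_) τ p
  rcases x with x | ⟨⟨rfl⟩⟩
  · rfl
  · exact hab

/-- The canonical representative of a syntactic class. -/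
noncomputable def syntRep (A : M.Alg) {C : I → Type u} (f : ∀ i, A.carrier i → C i)
    (i : I) (a : A.carrier i) : A.carrier i :=
  (Quotient.mk (syntSetoid A f i) a).out

theorem syntRep_eq {i : I} {a b : A.carrier i} (hab : syntSetoid A f i a b) :
    syntRep A f i a = syntRep A f i b :=
  congrArg Quotient.out (Quotient.sound (s := syntSetoid A f i) hab)

theorem syntRep_equiv (i : I) (a : A.carrier i) : syntSetoid A f i (syntRep A f i a) a :=
  Quotient.mk_out (s := syntSetoid A f i) a

/-- The canonical representative of a fibre of `h`. -/
noncomputable def fibreRep {X Y : I → Type u} (h : ∀ i, X i → Y i) (i : I) (a : X i) : X i :=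
  (Quotient.mk (Setoid.ker (h i)) a).out

theorem fibreRep_eq {X Y : I → Type u} {h : ∀ i, X i → Y i} {i : I} {a b : X i}
    (hab : h i a = h i b) : fibreRep h i a = fibreRep h i b :=
  congrArg Quotient.out (Quotient.sound (s := Setoid.ker (h i)) hab)

theorem apply_fibreRep {X Y : I → Type u} (h : ∀ i, X i → Y i) (i : I) (a : X i) :
    h i (fibreRep h i a) = h i a :=
  Quotient.mk_out (s := Setoid.ker (h i)) a

open Classical in
/-- Choose the syntactic representative over the fibres in `F`, and the representative of the
fibre elsewhere. -/
noncomputable def partialRep (f : ∀ i, A.carrier i → C i) {Y : I → Type u}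
    (h : ∀ i, A.carrier i → Y i) (F : Finset ((i : I) × Y i)) (i : I) (a : A.carrier i) :
    A.carrier i :=
  if ⟨i, h i a⟩ ∈ F then syntRep A f i a else fibreRep h i a

/-- Modifying finitely many fibres does not change the syntactic class of a product. -/
theorem syntSetoid_mul_partialRep {B : M.Alg} {h : ∀ i, A.carrier i → B.carrier i}
    (hhom : M.IsHom A B h) (hrec : M.Recognises A B h f) {τ : I} (w : M.T A.carrier τ)
    (F : Finset ((i : I) × B.carrier i)) :
    syntSetoid A f τ (A.mul τ w) (A.mul τ (M.map (partialRep f h F) τ w)) := by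
  classical
  induction F using Finset.induction_on with
  | empty =>
    refine syntSetoid_of_hom_eq hhom hrec ?_
    rw [hhom, hhom, map_map]
    congr 1
    exact map_congr (fun i a => by simp [partialRep, apply_fibreRep]) τ w
  | insert y F hy ih =>
    refine (syntSetoid A f τ).trans ih ?_
    obtain ⟨σ, b⟩ := y
    by_cases hb : ∃ a, h σ a = b
    · obtain ⟨c, rfl⟩ := hb
      let k : ∀ i, A.carrier i → WithVar A.carrier σ i := fun i a =>
        if e : (⟨i, h i a⟩ : (i : I) × B.carrier i) = ⟨σ, h σ c⟩ then
          Sum.inr ⟨congrArg Sigma.fst e⟩ else Sum.inl (partialRep f h F i a)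
      have hc : syntSetoid A f σ (fibreRep h σ c) (syntRep A f σ c) :=
        (syntSetoid A f σ).trans (syntSetoid_of_hom_eq hhom hrec (apply_fibreRep h σ c))
          ((syntSetoid A f σ).symm (syntRep_equiv σ c))
      have key := syntSetoid_polyEval hc (M.map k τ w)
      unfold polyEval at key
      rw [map_map, map_map] at key
      convert key using 2
      · refine map_congr (fun i a => ?_) τ w
        by_cases e : (⟨i, h i a⟩ : (i : I) × B.carrier i) = ⟨σ, h σ c⟩
        · have hi : i = σ := congrArg Sigma.fst e
          subst hi
          have ha : h i a = h i c := by simpa using e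
          simp [k, plug, partialRep, ha, hy, fibreRep_eq ha]
        · simp only [k, plug, dif_neg e, Sum.elim_inl, id]
      · refine map_congr (fun i a => ?_) τ w
        by_cases e : (⟨i, h i a⟩ : (i : I) × B.carrier i) = ⟨σ, h σ c⟩
        · have hi : i = σ := congrArg Sigma.fst e
          subst hi
          have ha : h i a = h i c := by simpa using e
          simp [k, plug, partialRep, ha, syntRep_eq (syntSetoid_of_hom_eq hhom hrec ha)]
        · simp only [k, plug, dif_neg e, Sum.elim_inl, id, partialRep, Finset.mem_insert, e,
            false_or]
    · rw [map_congr (g := partialRep f h (insert ⟨σ, b⟩ F)) fun i a => ?_]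
      have e : (⟨i, h i a⟩ : (i : I) × B.carrier i) ≠ ⟨σ, b⟩ := by
        intro e
        have hi : i = σ := congrArg Sigma.fst e
        subst hi
        exact hb ⟨a, by simpa using e⟩
      simp only [partialRep, Finset.mem_insert, e, false_or]

/-- Syntactic equivalence is compatible with multiplication, when the colouring is recognised
by a finitary algebra. -/
theorem syntSetoid_mul_syntRep {B : M.Alg} {h : ∀ i, A.carrier i → B.carrier i}
    (hhom : M.IsHom A B h) (hfin : M.Finitary B) (hrec : M.Recognises A B h f) {τ : I}
    (w : M.T A.carrier τ) :
    syntSetoid A f τ (A.mul τ w) (A.mul τ (M.map (syntRep A f) τ w)) := by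
  classical
  obtain ⟨S, hS, w₀, hw₀⟩ := hfin τ (M.map h τ w)
  let F : Finset ((i : I) × B.carrier i) :=
    (Set.finite_range fun x : (i : I) × ↥(S i) =>
      (⟨x.1, x.2⟩ : (i : I) × B.carrier i)).toFinset
  have hF : ∀ i (x : ↥(S i)), (⟨i, x⟩ : (i : I) × B.carrier i) ∈ F := fun i x => by
    simp only [F, Set.Finite.mem_toFinset]
    exact ⟨⟨i, x⟩, rfl⟩
  refine (syntSetoid A f τ).trans (syntSetoid_mul_partialRep hhom hrec w F)
    (syntSetoid_of_hom_eq hhom hrec ?_)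
  let β : ∀ i, B.carrier i → B.carrier i := fun i b =>
    if hb : ∃ a, h i a = b then h i (syntRep A f i hb.choose) else b
  let βF : ∀ i, B.carrier i → B.carrier i := fun i b => if ⟨i, b⟩ ∈ F then β i b else b
  have hβ : ∀ i a, h i (syntRep A f i a) = β i (h i a) := fun i a => by
    have hb : ∃ a', h i a' = h i a := ⟨a, rfl⟩
    simp only [β, dif_pos hb]
    rw [syntRep_eq (syntSetoid_of_hom_eq hhom hrec hb.choose_spec)]
  have hβF : ∀ i a, h i (partialRep f h F i a) = βF i (h i a) := fun i a => by
    by_cases hm : (⟨i, h i a⟩ : (i : I) × B.carrier i) ∈ F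
    · simp only [partialRep, βF, if_pos hm, hβ]
    · simp only [partialRep, βF, if_neg hm, apply_fibreRep]
  rw [hhom, hhom, map_map, map_map, map_congr hβ, map_congr hβF, ← map_map β, ← map_map βF,
    ← hw₀, map_map, map_map]
  congr 1
  exact map_congr (fun i x => by simp only [βF, if_pos (hF i x)]) τ w₀

/-- The quotient of an algebra by syntactic equivalence, when this is a congruence. -/
noncomputable def syntAlg (A : M.Alg) {C : I → Type u} (f : ∀ i, A.carrier i → C i)
    (H : ∀ (τ : I) (w : M.T A.carrier τ),
      syntSetoid A f τ (A.mul τ w) (A.mul τ (M.map (syntRep A f) τ w))) : M.Alg where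
  carrier i := Quotient (syntSetoid A f i)
  mul i w := Quotient.mk (syntSetoid A f i) (A.mul i (M.map (fun _ => Quotient.out) i w))
  mul_unit i a := by rw [M.unit_nat, A.mul_unit, Quotient.out_eq]
  mul_assoc i w := by
    rw [M.mult_nat, A.mul_assoc, map_map, map_map]
    refine Quotient.sound ((syntSetoid A f i).trans (H i _) ?_)
    rw [map_map]
    exact (syntSetoid A f i).refl _

theorem isHom_syntAlg (H : ∀ (τ : I) (w : M.T A.carrier τ),
      syntSetoid A f τ (A.mul τ w) (A.mul τ (M.map (syntRep A f) τ w))) :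
    M.IsHom A (syntAlg A f H) fun i => Quotient.mk (syntSetoid A f i) := by
  intro i w
  have e : A.mul i (M.map (syntRep A f) i w) = A.mul i (M.map (fun _ => Quotient.out) i
      (M.map (fun i => Quotient.mk (syntSetoid A f i)) i w)) := by
    rw [map_map]
    rfl
  exact (Quotient.sound (H i w)).trans (congrArg (Quotient.mk (syntSetoid A f i)) e)

/-- The quotient map by syntactic equivalence is a syntactic morphism. -/
theorem isSyntacticMorphism_syntAlg (H : ∀ (τ : I) (w : M.T A.carrier τ),
      syntSetoid A f τ (A.mul τ w) (A.mul τ (M.map (syntRep A f) τ w))) :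
    M.IsSyntacticMorphism A f (syntAlg A f H) fun i => Quotient.mk (syntSetoid A f i) := by
  refine ⟨isHom_syntAlg H, fun i => Quotient.mk_surjective,
    ⟨fun i => Quotient.lift (f i) fun _ _ hab => colour_eq_of_syntSetoid hab, fun _ _ => rfl⟩,
    fun B' h' hhom hsurj hrec => ?_⟩
  have hg : ∀ i a, Quotient.mk (syntSetoid A f i) (Function.surjInv (hsurj i) (h' i a)) =
      Quotient.mk (syntSetoid A f i) a := fun i a =>
    Quotient.sound (syntSetoid_of_hom_eq hhom hrec (Function.surjInv_eq (hsurj i) (h' i a)))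
  exact ⟨fun i b => Quotient.mk (syntSetoid A f i) (Function.surjInv (hsurj i) b),
    hhom.of_comp_surjective hsurj (isHom_syntAlg H) hg, hg⟩

end Syntactic

end SortedMonad

/-- **Syntactic Morphism Theorem.** Every colouring recognised by a T-morphism into a
finitary T-algebra has a syntactic morphism, and this syntactic morphism is unique up to
isomorphism. -/
theorem syntactic_morphism_theorem {I : Type u} (M : SortedMonad I) (A : M.Alg)
    (C : I → Type u) (f : ∀ i, A.carrier i → C i)
    (B : M.Alg) (h : ∀ i, A.carrier i → B.carrier i)
    (hhom : M.IsHom A B h) (hfin : M.Finitary B) (hrec : M.Recognises A B h f) :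
    (∃ (Af : M.Alg) (s : ∀ i, A.carrier i → Af.carrier i),
      M.IsSyntacticMorphism A f Af s) ∧
    (∀ (A₁ : M.Alg) (s₁ : ∀ i, A.carrier i → A₁.carrier i)
       (A₂ : M.Alg) (s₂ : ∀ i, A.carrier i → A₂.carrier i),
      M.IsSyntacticMorphism A f A₁ s₁ → M.IsSyntacticMorphism A f A₂ s₂ →
        ∃ iso : ∀ i, A₁.carrier i → A₂.carrier i,
          M.IsHom A₁ A₂ iso ∧ (∀ i, Function.Bijective (iso i)) ∧
            ∀ i a, iso i (s₁ i a) = s₂ i a) := by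
  refine ⟨⟨_, _, SortedMonad.isSyntacticMorphism_syntAlg fun _ w =>
    SortedMonad.syntSetoid_mul_syntRep hhom hfin hrec w⟩, ?_⟩
  intro A₁ s₁ A₂ s₂ h₁ h₂
  exact h₁.exists_iso h₂
end

section
/- Let T be a monad on the category of I-sorted sets, let A be a T-algebra, and let f : A → C be a colouring. Define the syntactic equivalence ∼ on A by: a ∼ b iff a and b have the same sort τ and f(eval(p, a)) = f(eval(p, b)) for every unary polynomial p over A with input sort τ. Then ∼ is a congruence with respect to polynomials with finitely many variables: for every sorted variable set X with finitely many elements, every polynomial p ∈ T(A ⊔ X), and all sort-preserving valuations v₁, v₂ : X → A satisfying v₁(x) ∼ v₂(x) for every x ∈ X, one has eval(p, v₁) ∼ eval(p, v₂). -/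
universe u

namespace SortedMonad

variable {I : Type u} (M : SortedMonad I)

/-- Evaluation of a polynomial `p ∈ T(A ⊔ X)` of sort `σ` at a valuation `v : X → A`. -/
def evalPoly (A : M.Alg) {X : I → Type u} (v : ∀ i, X i → A.carrier i) {σ : I}
    (p : M.T (fun i => A.carrier i ⊕ X i) σ) : A.carrier σ :=
  A.mul σ (M.map (fun i => Sum.elim id (v i)) σ p)

end SortedMonad

/-- The sorted variable set consisting of a single variable of sort `τ`. -/
def UVar {I : Type u} (τ : I) : I → Type u := fun i => ULift.{u} (PLift (i = τ))

/-- The valuation sending the unique variable of sort `τ` to `a`. -/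
def uval {I : Type u} (M : SortedMonad I) (A : M.Alg) (τ : I) (a : A.carrier τ) :
    ∀ i, UVar τ i → A.carrier i :=
  fun _ x => cast (congrArg A.carrier x.down.down.symm) a

namespace SortedMonad

variable {I : Type u} (M : SortedMonad I)

/-- The syntactic equivalence of a colouring `f`: elements `a, b` of the same sort `τ`
are equivalent if `f(eval(p, a)) = f(eval(p, b))` for every unary polynomial `p` with
input sort `τ`. -/
def SyntEq (A : M.Alg) {C : I → Type u} (f : ∀ i, A.carrier i → C i)
    (τ : I) (a b : A.carrier τ) : Prop :=
  ∀ (σ : I) (p : M.T (fun i => A.carrier i ⊕ UVar τ i) σ),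
    f σ (M.evalPoly A (uval M A τ a) p) = f σ (M.evalPoly A (uval M A τ b) p)

end SortedMonad

namespace SortedMonad

variable {I : Type u} (M : SortedMonad I)

/-- Simultaneous substitution of polynomials for the variables of a polynomial. -/
def substPoly {A X Y : I → Type u} (s : ∀ i, X i → M.T (fun i => A i ⊕ Y i) i) {σ : I}
    (p : M.T (fun i => A i ⊕ X i) σ) : M.T (fun i => A i ⊕ Y i) σ :=
  M.mult σ (M.map (fun i => Sum.elim (fun a => M.unit i (Sum.inl a)) (s i)) σ p)

variable {M} {A : M.Alg} {C : I → Type u} {f : ∀ i, A.carrier i → C i} {X Y : I → Type u}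

theorem evalPoly_unit (v : ∀ i, X i → A.carrier i) {σ : I} (z : A.carrier σ ⊕ X σ) :
    M.evalPoly A v (M.unit σ z) = Sum.elim id (v σ) z := by
  rw [evalPoly, M.unit_nat, A.mul_unit]

theorem evalPoly_substPoly (v : ∀ i, Y i → A.carrier i)
    (s : ∀ i, X i → M.T (fun i => A.carrier i ⊕ Y i) i) {σ : I}
    (p : M.T (fun i => A.carrier i ⊕ X i) σ) :
    M.evalPoly A v (M.substPoly s p) = M.evalPoly A (fun i x => M.evalPoly A v (s i x)) p := by
  unfold evalPoly substPoly
  rw [M.mult_nat, A.mul_assoc, ← M.map_comp, ← M.map_comp]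
  congr 2
  funext i z
  rcases z with a | x
  · exact evalPoly_unit v (Sum.inl a)
  · rfl

theorem SyntEq.refl (τ : I) (a : A.carrier τ) : M.SyntEq A f τ a a :=
  fun _ _ => rfl

/-- Replacing the value of a single variable by an equivalent one does not change the colour. -/
theorem SyntEq.evalPoly_update [DecidableEq ((i : I) × X i)] {z : (i : I) × X i}
    {a b : A.carrier z.1} (h : M.SyntEq A f z.1 a b) (v : ∀ y : (i : I) × X i, A.carrier y.1)
    {σ : I} (p : M.T (fun i => A.carrier i ⊕ X i) σ) :
    f σ (M.evalPoly A (fun i x => Function.update v z a ⟨i, x⟩) p) =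
      f σ (M.evalPoly A (fun i x => Function.update v z b ⟨i, x⟩) p) := by
  let s : ∀ i, X i → M.T (fun i => A.carrier i ⊕ UVar z.1 i) i := fun i x =>
    if e : (⟨i, x⟩ : (i : I) × X i) = z then M.unit i (Sum.inr ⟨⟨congrArg Sigma.fst e⟩⟩)
    else M.unit i (Sum.inl (v ⟨i, x⟩))
  have key (c : A.carrier z.1) : M.evalPoly A (uval M A z.1 c) (M.substPoly s p) =
      M.evalPoly A (fun i x => Function.update v z c ⟨i, x⟩) p := by
    rw [evalPoly_substPoly]
    congr 1
    funext i x
    by_cases e : (⟨i, x⟩ : (i : I) × X i) = z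
    · subst e
      simp only [s, dif_pos, Function.update_self, evalPoly_unit]
      rfl
    · simp [s, e, evalPoly_unit]
  rw [← key a, ← key b]
  exact h σ _

theorem SyntEq.apply_evalPoly_eq [Finite ((i : I) × X i)] {v₁ v₂ : ∀ i, X i → A.carrier i}
    (hv : ∀ i x, M.SyntEq A f i (v₁ i x) (v₂ i x)) {σ : I}
    (p : M.T (fun i => A.carrier i ⊕ X i) σ) :
    f σ (M.evalPoly A v₁ p) = f σ (M.evalPoly A v₂ p) := by
  classical
  have := Fintype.ofFinite ((i : I) × X i)
  suffices H : ∀ (s : Finset ((i : I) × X i)) (w₁ w₂ : ∀ y : (i : I) × X i, A.carrier y.1),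
      (∀ y, M.SyntEq A f y.1 (w₁ y) (w₂ y)) → (∀ y ∉ s, w₁ y = w₂ y) →
      f σ (M.evalPoly A (fun i x => w₁ ⟨i, x⟩) p) =
        f σ (M.evalPoly A (fun i x => w₂ ⟨i, x⟩) p) from
    H Finset.univ (fun y => v₁ y.1 y.2) (fun y => v₂ y.1 y.2) (fun y => hv y.1 y.2)
      fun y hy => (hy (Finset.mem_univ y)).elim
  intro s
  induction s using Finset.induction_on with
  | empty =>
    intro w₁ w₂ _ h
    rw [funext fun y => h y (Finset.notMem_empty y)]
  | insert z s _ ih =>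
    intro w₁ w₂ hw h
    have step := (hw z).evalPoly_update w₁ p
    rw [Function.update_eq_self] at step
    refine step.trans (ih _ w₂ (fun y => ?_) fun y hy => ?_) <;>
      obtain rfl | hyz := eq_or_ne y z
    · rw [Function.update_self]
      exact SyntEq.refl _ _
    · rw [Function.update_of_ne hyz]
      exact hw y
    · exact Function.update_self ..
    · rw [Function.update_of_ne hyz]
      exact h y (by simp [hyz, hy])

end SortedMonad

/-- The syntactic equivalence is a congruence with respect to polynomials with finitely
many variables. -/
theorem syntactic_equivalence_is_polynomial_congruence {I : Type u} (M : SortedMonad I)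
    (A : M.Alg) (C : I → Type u) (f : ∀ i, A.carrier i → C i)
    (X : I → Type u) (hX : Finite ((i : I) × X i))
    (σ : I) (p : M.T (fun i => A.carrier i ⊕ X i) σ)
    (v₁ v₂ : ∀ i, X i → A.carrier i)
    (hv : ∀ i x, M.SyntEq A f i (v₁ i x) (v₂ i x)) :
    M.SyntEq A f σ (M.evalPoly A v₁ p) (M.evalPoly A v₂ p) := by
  intro ρ r
  let s : ∀ i, UVar σ i → M.T (fun i => A.carrier i ⊕ X i) i :=
    fun _ x => cast (congrArg _ x.down.down.symm) p
  have key (v : ∀ i, X i → A.carrier i) :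
      M.evalPoly A (uval M A σ (M.evalPoly A v p)) r = M.evalPoly A v (M.substPoly s r) := by
    rw [SortedMonad.evalPoly_substPoly]
    congr 1
    funext i x
    obtain ⟨⟨rfl⟩⟩ := x
    rfl
  rw [key, key]
  exact SortedMonad.SyntEq.apply_evalPoly_eq hv _
end

section
/- Let T be a monad on the category of I-sorted sets, let A be a T-algebra, let f : A → C be a colouring, and let ∼ be the syntactic equivalence of f (a ∼ b iff a, b have the same sort τ and f(eval(p, a)) = f(eval(p, b)) for every unary polynomial p over A with input sort τ). If h : A → B is a T-morphism recognising f (i.e. f factors through h), then the quotient map by ∼ factors through h; equivalently, for all a, b ∈ A of the same sort, h(a) = h(b) implies a ∼ b. -/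
universe u

namespace SortedMonad

variable {I : Type u} {M : SortedMonad I}

/-- A morphism of algebras maps the value of a polynomial at `v` to the product in the codomain of
the term obtained by applying `h` to the constants and `h ∘ v` to the variables. -/
theorem IsHom.apply_evalPoly {A B : M.Alg}
    {h : ∀ i, A.carrier i → B.carrier i} (hhom : M.IsHom A B h) {X : I → Type u}
    (v : ∀ i, X i → A.carrier i) {σ : I} (p : M.T (fun i => A.carrier i ⊕ X i) σ) :
    h σ (M.evalPoly A v p) =
      B.mul σ (M.map (fun i => Sum.elim (h i) (h i ∘ v i)) σ p) := by
  rw [evalPoly, hhom, ← M.map_comp]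
  simp only [Sum.comp_elim, Function.comp_id]

/-- A sorted function `h` carries the valuation at `a` to the valuation at `h τ a`. -/
theorem apply_uval {A B : M.Alg} (h : ∀ i, A.carrier i → B.carrier i) (τ : I)
    (a : A.carrier τ) (i : I) : h i ∘ uval M A τ a i = uval M B τ (h τ a) i := by
  funext ⟨⟨e⟩⟩
  subst e
  rfl

end SortedMonad

/-- If a T-morphism `h` recognises the colouring `f`, then the syntactic equivalence of
`f` factors through `h`: elements with the same image under `h` are syntactically
equivalent. -/
theorem syntactic_equivalence_factors_through_recognisers {I : Type u}
    (M : SortedMonad I) (A B : M.Alg) (C : I → Type u)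
    (f : ∀ i, A.carrier i → C i) (h : ∀ i, A.carrier i → B.carrier i)
    (hhom : M.IsHom A B h) (hrec : M.Recognises A B h f)
    (τ : I) (a b : A.carrier τ) (hab : h τ a = h τ b) :
    M.SyntEq A f τ a b := by
  obtain ⟨f', hf⟩ := hrec
  intro σ p
  simp only [hf, hhom.apply_evalPoly, SortedMonad.apply_uval, hab]
end

section
/- (Syntactic Pseudovariety Theorem) Let T be a monad on the category of sets. Assume: (i) every recognisable T-language L ⊆ T Σ has a syntactic morphism; (ii) every finite T-algebra A is finitely generated, i.e. there is a finite subset G of its universe such that every element of A is of the form mul_A(T(incl)(u)) for some u ∈ T G, where incl : G → A is the inclusion; (iii) every finite T-algebra A has a finite subset A₀ of its universe such that every surjective T-morphism out of A that is injective on A₀ is an isomorphism. Then makelang is a bijection between algebra pseudovarieties and syntactic language pseudovarieties, with inverse makealg. Concretely: for every algebra pseudovariety 𝔸, makelang 𝔸 is a syntactic language pseudovariety and makealg(makelang 𝔸) = 𝔸; and for every syntactic language pseudovariety 𝕃, makealg 𝕃 is an algebra pseudovariety and makelang(makealg 𝕃) = 𝕃. -/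
universe u

structure SetMonad : Type (u + 1) where
  T : Type u → Type u
  map : {X Y : Type u} → (X → Y) → T X → T Y
  unit : {X : Type u} → X → T X
  mult : {X : Type u} → T (T X) → T X
  map_id : ∀ {X : Type u} (w : T X), map id w = w
  map_comp : ∀ {X Y Z : Type u} (g : Y → Z) (f : X → Y) (w : T X),
    map (g ∘ f) w = map g (map f w)
  unit_nat : ∀ {X Y : Type u} (f : X → Y) (x : X), map f (unit x) = unit (f x)
  mult_nat : ∀ {X Y : Type u} (f : X → Y) (w : T (T X)),
    map f (mult w) = mult (map (map f) w)
  mult_unit : ∀ {X : Type u} (w : T X), mult (unit w) = w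
  mult_map_unit : ∀ {X : Type u} (w : T X), mult (map unit w) = w
  mult_assoc : ∀ {X : Type u} (w : T (T (T X))), mult (mult w) = mult (map mult w)

structure SetMonad.Alg (M : SetMonad.{u}) : Type (u + 1) where
  carrier : Type u
  mul : M.T carrier → carrier
  mul_unit : ∀ a, mul (M.unit a) = a
  mul_assoc : ∀ w, mul (M.mult w) = mul (M.map mul w)

namespace SetMonad

variable (M : SetMonad.{u})

/-- `h` is a morphism of Eilenberg–Moore `T`-algebras. -/
def IsHom (A B : M.Alg) (h : A.carrier → B.carrier) : Prop :=
  ∀ w, h (A.mul w) = B.mul (M.map h w)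

/-- The free `T`-algebra on a set. -/
def Free (Sig : Type u) : M.Alg where
  carrier := M.T Sig
  mul := M.mult
  mul_unit := M.mult_unit
  mul_assoc := M.mult_assoc

/-- Unary polynomials over an algebra: elements of `T (A ⊕ {x})`. -/
def UPoly (A : M.Alg) : Type u := M.T (A.carrier ⊕ PUnit.{u + 1})

/-- Evaluation of a unary polynomial at a point. -/
def evalPoly (A : M.Alg) (p : M.UPoly A) (a : A.carrier) : A.carrier :=
  A.mul (M.map (Sum.elim id fun _ => a) p)

/-- Polynomial derivative of a language. -/
def deriv {Sig : Type u} (p : M.UPoly (M.Free Sig)) (L : Set (M.T Sig)) : Set (M.T Sig) :=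
  {w | M.evalPoly (M.Free Sig) p w ∈ L}

/-- A language is recognisable if it is a morphism preimage from a finite algebra. -/
def Recognisable (A : M.Alg) (L : Set A.carrier) : Prop :=
  ∃ (B : M.Alg) (h : A.carrier → B.carrier) (F : Set B.carrier),
    Finite B.carrier ∧ M.IsHom A B h ∧ L = h ⁻¹' F

/-- `h` is a syntactic morphism of `L`. -/
def IsSynMorphism {Sig : Type u} (L : Set (M.T Sig)) (B : M.Alg)
    (h : M.T Sig → B.carrier) : Prop :=
  Finite B.carrier ∧ M.IsHom (M.Free Sig) B h ∧ Function.Surjective h ∧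
    ∀ w w' : M.T Sig, h w = h w' ↔
      ∀ p : M.UPoly (M.Free Sig),
        (M.evalPoly (M.Free Sig) p w ∈ L ↔ M.evalPoly (M.Free Sig) p w' ∈ L)

/-- The product of two `T`-algebras. -/
def prodAlg (A B : M.Alg) : M.Alg where
  carrier := A.carrier × B.carrier
  mul w := (A.mul (M.map Prod.fst w), B.mul (M.map Prod.snd w))
  mul_unit a := by
    show (A.mul (M.map Prod.fst (M.unit a)), B.mul (M.map Prod.snd (M.unit a))) = a
    rw [M.unit_nat, M.unit_nat, A.mul_unit, B.mul_unit]
  mul_assoc w := by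
    show (A.mul (M.map Prod.fst (M.mult w)), B.mul (M.map Prod.snd (M.mult w))) = _
    rw [M.mult_nat, M.mult_nat, A.mul_assoc, B.mul_assoc,
      ← M.map_comp, ← M.map_comp]
    show _ = (A.mul (M.map Prod.fst (M.map _ w)), B.mul (M.map Prod.snd (M.map _ w)))
    rw [← M.map_comp, ← M.map_comp]
    rfl

/-- The subalgebra on a multiplication-closed subset. -/
def subAlg (A : M.Alg) (S : Set A.carrier)
    (hS : ∀ w : M.T ↥S, A.mul (M.map Subtype.val w) ∈ S) : M.Alg where
  carrier := ↥S
  mul w := ⟨A.mul (M.map Subtype.val w), hS w⟩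
  mul_unit a := by
    apply Subtype.ext
    show A.mul (M.map Subtype.val (M.unit a)) = a.val
    rw [M.unit_nat, A.mul_unit]
  mul_assoc w := by
    apply Subtype.ext
    show A.mul (M.map Subtype.val (M.mult w)) = A.mul (M.map Subtype.val (M.map _ w))
    rw [M.mult_nat, A.mul_assoc, ← M.map_comp, ← M.map_comp]
    rfl

/-- A class of finite `T`-algebras is an algebra pseudovariety if it is closed under
binary products, surjective morphic images, and subalgebras. -/
def IsAlgPV (P : M.Alg → Prop) : Prop :=
  (∀ A, P A → Finite A.carrier) ∧
  (∀ A B, P A → P B → P (M.prodAlg A B)) ∧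
  (∀ (A B : M.Alg) (h : A.carrier → B.carrier),
    P A → M.IsHom A B h → Function.Surjective h → P B) ∧
  (∀ (A : M.Alg) (S : Set A.carrier) (hS : ∀ w : M.T ↥S, A.mul (M.map Subtype.val w) ∈ S),
    P A → P (M.subAlg A S hS))

/-- All members of the class are T-languages: recognisable languages over finite alphabets. -/
def IsLangClass (P : ∀ Sig : Type u, Set (M.T Sig) → Prop) : Prop :=
  ∀ (Sig : Type u) (L : Set (M.T Sig)), P Sig L → Finite Sig ∧ M.Recognisable (M.Free Sig) L

/-- Closure under Boolean combinations over a common alphabet. -/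
def ClosedBool (P : ∀ Sig : Type u, Set (M.T Sig) → Prop) : Prop :=
  (∀ (Sig : Type u) (L K : Set (M.T Sig)), P Sig L → P Sig K → P Sig (L ∪ K)) ∧
  (∀ (Sig : Type u) (L K : Set (M.T Sig)), P Sig L → P Sig K → P Sig (L ∩ K)) ∧
  (∀ (Sig : Type u) (L : Set (M.T Sig)), P Sig L → P Sig Lᶜ)

/-- Closure under preimages of `T`-morphisms between free algebras on finite alphabets. -/
def ClosedPreimage (P : ∀ Sig : Type u, Set (M.T Sig) → Prop) : Prop :=
  ∀ (Sig Gam : Type u) (L : Set (M.T Sig)) (h : M.T Gam → M.T Sig),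
    Finite Gam → P Sig L → M.IsHom (M.Free Gam) (M.Free Sig) h → P Gam (h ⁻¹' L)

/-- Closure under polynomial derivatives. -/
def ClosedPolyDeriv (P : ∀ Sig : Type u, Set (M.T Sig) → Prop) : Prop :=
  ∀ (Sig : Type u) (L : Set (M.T Sig)) (p : M.UPoly (M.Free Sig)),
    P Sig L → P Sig (M.deriv p L)

/-- Closure under syntactic derivatives: all languages recognised by a syntactic
morphism of a member. -/
def ClosedSynDeriv (P : ∀ Sig : Type u, Set (M.T Sig) → Prop) : Prop :=
  ∀ (Sig : Type u) (L : Set (M.T Sig)) (B : M.Alg) (h : M.T Sig → B.carrier)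
    (F : Set B.carrier), P Sig L → M.IsSynMorphism L B h → P Sig (h ⁻¹' F)

/-- Syntactic language pseudovariety. -/
def IsSynLangPV (P : ∀ Sig : Type u, Set (M.T Sig) → Prop) : Prop :=
  M.IsLangClass P ∧ M.ClosedBool P ∧ M.ClosedPreimage P ∧ M.ClosedSynDeriv P

/-- Polynomial language pseudovariety. -/
def IsPolyLangPV (P : ∀ Sig : Type u, Set (M.T Sig) → Prop) : Prop :=
  M.IsLangClass P ∧ M.ClosedBool P ∧ M.ClosedPreimage P ∧ M.ClosedPolyDeriv P

/-- The class of T-languages recognised by some algebra of the class `P`. -/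
def makelang (P : M.Alg → Prop) : ∀ Sig : Type u, Set (M.T Sig) → Prop :=
  fun Sig L => Finite Sig ∧
    ∃ (B : M.Alg) (h : M.T Sig → B.carrier) (F : Set B.carrier),
      P B ∧ M.IsHom (M.Free Sig) B h ∧ L = h ⁻¹' F

/-- The class of finite `T`-algebras all of whose recognised languages belong to `P`. -/
def makealg (P : ∀ Sig : Type u, Set (M.T Sig) → Prop) : M.Alg → Prop :=
  fun B => Finite B.carrier ∧
    ∀ (Sig : Type u) (h : M.T Sig → B.carrier) (F : Set B.carrier),
      Finite Sig → M.IsHom (M.Free Sig) B h → P Sig (h ⁻¹' F)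

end SetMonad

namespace SetMonad

variable {M : SetMonad.{u}}

theorem IsHom.comp {A B C : M.Alg} {g : B.carrier → C.carrier} {f : A.carrier → B.carrier}
    (hg : M.IsHom B C g) (hf : M.IsHom A B f) : M.IsHom A C (g ∘ f) := fun w => by
  rw [Function.comp_apply, hf, hg, M.map_comp]

theorem isHom_fst (A B : M.Alg) : M.IsHom (M.prodAlg A B) A Prod.fst := fun _ => rfl

theorem isHom_snd (A B : M.Alg) : M.IsHom (M.prodAlg A B) B Prod.snd := fun _ => rfl

theorem isHom_subtype_val (A : M.Alg) (S : Set A.carrier)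
    (hS : ∀ w : M.T ↥S, A.mul (M.map Subtype.val w) ∈ S) :
    M.IsHom (M.subAlg A S hS) A Subtype.val := fun _ => rfl

theorem IsHom.prodMk {A B C : M.Alg} {f : A.carrier → B.carrier} {g : A.carrier → C.carrier}
    (hf : M.IsHom A B f) (hg : M.IsHom A C g) :
    M.IsHom A (M.prodAlg B C) fun a => (f a, g a) := fun w => by
  refine Prod.ext ?_ ?_
  · change f (A.mul w) = B.mul (M.map Prod.fst (M.map _ w))
    rw [hf, ← M.map_comp]
    rfl
  · change g (A.mul w) = C.mul (M.map Prod.snd (M.map _ w))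
    rw [hg, ← M.map_comp]
    rfl

/-- The morphism from a free algebra extending a function on the generators. -/
def extend {Sig : Type u} (A : M.Alg) (f : Sig → A.carrier) (w : M.T Sig) : A.carrier :=
  A.mul (M.map f w)

theorem isHom_extend {Sig : Type u} (A : M.Alg) (f : Sig → A.carrier) :
    M.IsHom (M.Free Sig) A (extend A f) := fun (w : M.T (M.T Sig)) => by
  change A.mul (M.map f (M.mult w)) = A.mul (M.map (A.mul ∘ M.map f) w)
  rw [M.mult_nat, A.mul_assoc, ← M.map_comp]

theorem IsHom.eq_extend {Sig : Type u} {A : M.Alg} {h : M.T Sig → A.carrier}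
    (hh : M.IsHom (M.Free Sig) A h) : h = extend A (h ∘ M.unit) := by
  funext w
  rw [extend, M.map_comp]
  exact (congrArg h (M.mult_map_unit w).symm).trans (hh (M.map M.unit w))

/-- Free algebras are projective. -/
theorem IsHom.exists_lift {Sig : Type u} {A B : M.Alg} {g : A.carrier → B.carrier}
    {h : M.T Sig → B.carrier} (hg : M.IsHom A B g) (hsurj : Function.Surjective g)
    (hh : M.IsHom (M.Free Sig) B h) :
    ∃ h' : M.T Sig → A.carrier, M.IsHom (M.Free Sig) A h' ∧ h = g ∘ h' := by
  choose s hs using hsurj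
  refine ⟨extend A fun x => s (h (M.unit x)), isHom_extend A _, ?_⟩
  funext w
  rw [congrFun hh.eq_extend w, Function.comp_apply, extend, extend, hg, ← M.map_comp]
  congr 2
  funext x
  exact (hs _).symm

/-- A pseudovariety contains every algebra that is a quotient of the image of a morphism
into one of its members. -/
theorem IsAlgPV.mem_of_factor {P : M.Alg → Prop} (hP : M.IsAlgPV P) {A B C : M.Alg}
    (hC : P C) {k : A.carrier → C.carrier} {h : A.carrier → B.carrier}
    (hk : M.IsHom A C k) (hh : M.IsHom A B h) (hsurj : Function.Surjective h)
    (hker : ∀ a a', k a = k a' → h a = h a') : P B := by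
  choose s hs using fun c : ↥(Set.range k) => c.2
  have hval (w : M.T ↥(Set.range k)) :
      C.mul (M.map Subtype.val w) = k (A.mul (M.map s w)) := by
    rw [hk, ← M.map_comp]
    congr 2
    funext c
    exact (hs c).symm
  have hS (w : M.T ↥(Set.range k)) : C.mul (M.map Subtype.val w) ∈ Set.range k :=
    ⟨_, (hval w).symm⟩
  refine hP.2.2.1 (M.subAlg C (Set.range k) hS) B (h ∘ s) (hP.2.2.2 C _ hS hC) ?_ ?_
  · intro (w : M.T ↥(Set.range k))
    have hker' := hker _ (A.mul (M.map s w)) ((hs ((M.subAlg C _ hS).mul w)).trans (hval w))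
    refine hker'.trans ?_
    rw [hh, ← M.map_comp]
    rfl
  · intro b
    obtain ⟨a, rfl⟩ := hsurj b
    exact ⟨⟨k a, a, rfl⟩, hker _ _ (hs _)⟩

theorem IsHom.apply_evalPoly {A B : M.Alg} {k : A.carrier → B.carrier} (hk : M.IsHom A B k)
    (p : M.UPoly A) (a : A.carrier) :
    k (M.evalPoly A p a) = B.mul (M.map (Sum.elim k fun _ => k a) p) := by
  refine (hk _).trans (congrArg B.mul ?_)
  refine (M.map_comp k (Sum.elim id fun _ => a) p).symm.trans ?_
  rw [Sum.comp_elim]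
  rfl

theorem IsSynMorphism.eq_of_recognised {Sig : Type u} {L : Set (M.T Sig)} {B C : M.Alg}
    {h : M.T Sig → B.carrier} (hh : M.IsSynMorphism L B h) {k : M.T Sig → C.carrier}
    (hk : M.IsHom (M.Free Sig) C k) {F : Set C.carrier} (hL : L = k ⁻¹' F) {w w' : M.T Sig}
    (hw : k w = k w') : h w = h w' := by
  refine (hh.2.2.2 w w').2 fun p => ?_
  subst hL
  have heq : k (M.evalPoly (M.Free Sig) p w) = k (M.evalPoly (M.Free Sig) p w') :=
    (hk.apply_evalPoly p w).trans ((congrArg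
      (fun c => C.mul (M.map (Sum.elim k fun _ => c) p)) hw).trans (hk.apply_evalPoly p w').symm)
  exact iff_of_eq (congrArg (· ∈ F) heq)

theorem IsSynMorphism.preimage_image {Sig : Type u} {L : Set (M.T Sig)} {B : M.Alg}
    {h : M.T Sig → B.carrier} (hh : M.IsSynMorphism L B h) : L = h ⁻¹' (h '' L) := by
  refine (Set.subset_preimage_image h L).antisymm ?_
  rintro w ⟨w', hw', heq⟩
  have key (v : M.T Sig) : M.evalPoly (M.Free Sig) (M.unit (Sum.inr PUnit.unit)) v = v :=
    (congrArg M.mult (M.unit_nat (Sum.elim id fun _ => v) _)).trans (M.mult_unit v)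
  have := (hh.2.2.2 w' w).1 heq (M.unit (Sum.inr PUnit.unit))
  rw [key, key] at this
  exact this.1 hw'

theorem IsAlgPV.isSynLangPV_makelang {P : M.Alg → Prop} (hP : M.IsAlgPV P) :
    M.IsSynLangPV (M.makelang P) := by
  refine ⟨?_, ⟨?_, ?_, ?_⟩, ?_, ?_⟩
  · rintro Sig L ⟨hSig, B, h, F, hB, hh, hL⟩
    exact ⟨hSig, B, h, F, hP.1 B hB, hh, hL⟩
  · rintro Sig _ _ ⟨hSig, B, h, F, hB, hh, rfl⟩ ⟨-, C, k, E, hC, hk, rfl⟩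
    exact ⟨hSig, M.prodAlg B C, _, Prod.fst ⁻¹' F ∪ Prod.snd ⁻¹' E, hP.2.1 B C hB hC,
      hh.prodMk hk, rfl⟩
  · rintro Sig _ _ ⟨hSig, B, h, F, hB, hh, rfl⟩ ⟨-, C, k, E, hC, hk, rfl⟩
    exact ⟨hSig, M.prodAlg B C, _, Prod.fst ⁻¹' F ∩ Prod.snd ⁻¹' E, hP.2.1 B C hB hC,
      hh.prodMk hk, rfl⟩
  · rintro Sig _ ⟨hSig, B, h, F, hB, hh, rfl⟩
    exact ⟨hSig, B, h, Fᶜ, hB, hh, rfl⟩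
  · rintro Sig Gam _ g hGam ⟨-, B, h, F, hB, hh, rfl⟩ hg
    exact ⟨hGam, B, h ∘ g, F, hB, hh.comp hg, rfl⟩
  · rintro Sig L B h F ⟨hSig, C, k, E, hC, hk, hL⟩ hh
    exact ⟨hSig, B, h, F,
      hP.mem_of_factor hC hk hh.2.1 hh.2.2.1 fun _ _ => hh.eq_of_recognised hk hL, hh.2.1, rfl⟩

theorem IsAlgPV.exists_separating {P : M.Alg → Prop} (hP : M.IsAlgPV P) {Sig : Type u}
    {B : M.Alg} {h : M.T Sig → B.carrier}
    (hrec : ∀ F : Set B.carrier, M.makelang P Sig (h ⁻¹' F)) {S : Set B.carrier}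
    (hS : S.Finite) :
    ∃ (C : M.Alg) (k : M.T Sig → C.carrier), P C ∧ M.IsHom (M.Free Sig) C k ∧
      ∀ b ∈ S, ∀ w w', k w = k w' → h w = b → h w' = b := by
  induction S, hS using Set.Finite.induction_on with
  | empty =>
    obtain ⟨-, C, k, -, hC, hk, -⟩ := hrec ∅
    exact ⟨C, k, hC, hk, fun b hb => hb.elim⟩
  | @insert b S _ _ ih =>
    obtain ⟨C, k, hC, hk, hsep⟩ := ih
    obtain ⟨-, D, l, E, hD, hl, hE⟩ := hrec {b}
    refine ⟨M.prodAlg C D, _, hP.2.1 C D hC hD, hk.prodMk hl, ?_⟩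
    rintro c (rfl | hc) w w' heq hw
    · have hl_eq : l w = l w' := congrArg Prod.snd heq
      have hmem : w ∈ l ⁻¹' E := hE ▸ hw
      rw [Set.mem_preimage, hl_eq, ← Set.mem_preimage, ← hE] at hmem
      exact hmem
    · exact hsep c hc w w' (congrArg Prod.fst heq) hw

theorem IsAlgPV.makealg_makelang {P : M.Alg → Prop} (hP : M.IsAlgPV P) :
    M.makealg (M.makelang P) = P := by
  funext B
  refine propext ⟨fun ⟨hfin, hB⟩ => ?_, fun hB =>
    ⟨hP.1 B hB, fun _ h F hSig hh => ⟨hSig, B, h, F, hB, hh, rfl⟩⟩⟩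
  have hmul : M.IsHom (M.Free B.carrier) B B.mul := B.mul_assoc
  obtain ⟨C, k, hC, hk, hsep⟩ := hP.exists_separating
    (fun F => hB B.carrier B.mul F hfin hmul) (Set.toFinite Set.univ)
  exact hP.mem_of_factor hC hk hmul (fun b => ⟨M.unit b, B.mul_unit b⟩)
    fun w w' heq => (hsep _ (Set.mem_univ _) w w' heq rfl).symm

theorem IsSynLangPV.isAlgPV_makealg {Q : ∀ Sig : Type u, Set (M.T Sig) → Prop}
    (hQ : M.IsSynLangPV Q) : M.IsAlgPV (M.makealg Q) := by
  refine ⟨fun A hA => hA.1, ?_, ?_, ?_⟩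
  · rintro A B ⟨hA, hQA⟩ ⟨hB, hQB⟩
    have hfin : Finite (A.carrier × B.carrier) := inferInstance
    refine ⟨hfin, fun Sig h F hSig hh => ?_⟩
    have hA' (E : Set A.carrier) := hQA Sig (Prod.fst ∘ h) E hSig ((isHom_fst A B).comp hh)
    have hB' (E : Set B.carrier) := hQB Sig (Prod.snd ∘ h) E hSig ((isHom_snd A B).comp hh)
    change Set (A.carrier × B.carrier) at F
    induction F, Set.toFinite F using Set.Finite.induction_on with
    | empty => exact hA' ∅
    | @insert c F _ _ ih =>
      have hc : Q Sig (h ⁻¹' {c}) := by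
        convert hQ.2.1.2.1 _ _ _ (hA' {c.1}) (hB' {c.2}) using 1
        ext w
        exact Prod.ext_iff
      exact hQ.2.1.1 _ _ _ hc ih
  · rintro A B g ⟨hA, hQA⟩ hg hsurj
    refine ⟨Finite.of_surjective g hsurj, fun Sig h F hSig hh => ?_⟩
    obtain ⟨h', hh', rfl⟩ := hg.exists_lift hsurj hh
    exact hQA Sig h' (g ⁻¹' F) hSig hh'
  · rintro A S hS ⟨hA, hQA⟩
    refine ⟨inferInstanceAs (Finite ↥S), fun Sig h F hSig hh => ?_⟩
    convert hQA Sig (Subtype.val ∘ h) (Subtype.val '' F) hSig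
      ((isHom_subtype_val A S hS).comp hh) using 1
    exact congrArg (h ⁻¹' ·) (Set.preimage_image_eq F Subtype.val_injective).symm

theorem IsSynLangPV.makelang_makealg {Q : ∀ Sig : Type u, Set (M.T Sig) → Prop}
    (hsyn : ∀ (Sig : Type u) (L : Set (M.T Sig)), Finite Sig →
      M.Recognisable (M.Free Sig) L →
      ∃ (B : M.Alg) (h : M.T Sig → B.carrier), M.IsSynMorphism L B h)
    (hQ : M.IsSynLangPV Q) : M.makelang (M.makealg Q) = Q := by
  funext Sig L
  refine propext ⟨?_, fun hL => ?_⟩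
  · rintro ⟨hSig, B, h, F, hB, hh, rfl⟩
    exact hB.2 Sig h F hSig hh
  · obtain ⟨hSig, hrec⟩ := hQ.1 Sig L hL
    obtain ⟨B, h, hh⟩ := hsyn Sig L hSig hrec
    refine ⟨hSig, B, h, h '' L, ⟨hh.1, fun Gam g F hGam hg => ?_⟩, hh.2.1, hh.preimage_image⟩
    obtain ⟨g', hg', rfl⟩ := IsHom.exists_lift hh.2.1 hh.2.2.1 hg
    exact hQ.2.2.1 Sig Gam (h ⁻¹' F) g' hGam (hQ.2.2.2 Sig L B h F hL hh) hg'

end SetMonad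

/-- **Syntactic Pseudovariety Theorem.**
Assuming (i) every recognisable T-language has a syntactic morphism, (ii) every finite
T-algebra is finitely generated, and (iii) every finite T-algebra has a finite
observable subset, the map `makelang` is a bijection between algebra pseudovarieties and
syntactic language pseudovarieties, with inverse `makealg`. -/
theorem syntactic_pseudovariety_theorem (M : SetMonad.{u})
    (h1 : ∀ (Sig : Type u) (L : Set (M.T Sig)), Finite Sig →
      M.Recognisable (M.Free Sig) L →
      ∃ (B : M.Alg) (h : M.T Sig → B.carrier), M.IsSynMorphism L B h)
    (h2 : ∀ A : M.Alg, Finite A.carrier → ∃ G : Set A.carrier, G.Finite ∧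
      ∀ a : A.carrier, ∃ u : M.T ↥G, A.mul (M.map Subtype.val u) = a)
    (h3 : ∀ A : M.Alg, Finite A.carrier → ∃ A₀ : Set A.carrier, A₀.Finite ∧
      ∀ (B : M.Alg) (h : A.carrier → B.carrier), M.IsHom A B h → Function.Surjective h →
        Set.InjOn h A₀ → Function.Bijective h) :
    (∀ P : M.Alg → Prop, M.IsAlgPV P →
      M.IsSynLangPV (M.makelang P) ∧ M.makealg (M.makelang P) = P) ∧
    (∀ Q : ∀ Sig : Type u, Set (M.T Sig) → Prop, M.IsSynLangPV Q →
      M.IsAlgPV (M.makealg Q) ∧ M.makelang (M.makealg Q) = Q) := by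
  exact ⟨fun _ hP => ⟨hP.isSynLangPV_makelang, hP.makealg_makelang⟩,
    fun _ hQ => ⟨hQ.isAlgPV_makealg, hQ.makelang_makealg h1⟩⟩
end

section
/- Let T be a monad on the category of sets, Σ a set, and let h : T Σ → B be a T-morphism from the free T-algebra on Σ into a T-algebra B which recognises a language L ⊆ T Σ (i.e. L = h⁻¹(F) for some F ⊆ B). Then for every unary polynomial p over the free algebra T Σ, the morphism h also recognises the polynomial derivative p⁻¹L; that is, there exists F' ⊆ B with p⁻¹L = h⁻¹(F'). -/
universe u

namespace SetMonad

/-- The polynomial obtained by applying `h` to the constants of `p`. -/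
def UPoly.map {M : SetMonad.{u}} {A B : M.Alg} (h : A.carrier → B.carrier) (p : M.UPoly A) :
    M.UPoly B :=
  M.map (Sum.map h id) p

/-- Morphisms commute with the evaluation of unary polynomials. -/
theorem IsHom.evalPoly {M : SetMonad.{u}} {A B : M.Alg} {h : A.carrier → B.carrier}
    (hh : M.IsHom A B h) (p : M.UPoly A) (a : A.carrier) :
    h (M.evalPoly A p a) = M.evalPoly B (p.map h) (h a) := by
  have elim_comp : h ∘ Sum.elim id (fun _ : PUnit => a) =
      Sum.elim id (fun _ => h a) ∘ Sum.map h id := by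
    ext (x | x) <;> rfl
  calc h (M.evalPoly A p a)
      = B.mul (M.map h (M.map (Sum.elim id fun _ => a) p)) := hh _
    _ = B.mul (M.map (h ∘ Sum.elim id fun _ => a) p) := congrArg B.mul (M.map_comp _ _ p).symm
    _ = B.mul (M.map (Sum.elim id (fun _ => h a) ∘ Sum.map h id) p) := by rw [elim_comp]
    _ = M.evalPoly B (p.map h) (h a) := congrArg B.mul (M.map_comp _ _ p)

end SetMonad

/-- A morphism recognising a language also recognises each of its polynomial
derivatives. -/
theorem recognises_polynomial_derivative (M : SetMonad.{u}) (Sig : Type u) (B : M.Alg)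
    (h : M.T Sig → B.carrier) (hh : M.IsHom (M.Free Sig) B h)
    (F : Set B.carrier) (L : Set (M.T Sig)) (hL : L = h ⁻¹' F)
    (p : M.UPoly (M.Free Sig)) :
    ∃ F' : Set B.carrier, M.deriv p L = h ⁻¹' F' := by
  refine ⟨{b | M.evalPoly B (p.map h) b ∈ F}, ?_⟩
  subst hL
  ext w
  exact iff_of_eq (congrArg (· ∈ F) (hh.evalPoly p w))
end

section
/- Let T be a monad on the category of sets, let Σ be a finite alphabet, let L ⊆ T Σ be a recognisable language, and let h : T Σ → B be a syntactic morphism of L (a surjective T-morphism into a finite T-algebra whose kernel is the syntactic equivalence of L). Then every language recognised by h is a Boolean combination of finitely many polynomial derivatives of L: for every F ⊆ B there is a finite set P of unary polynomials over T Σ such that h⁻¹(F) belongs to the Boolean algebra of subsets of T Σ generated by {p⁻¹L : p ∈ P}. -/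
universe u

/-- `BoolComb S s` says that `s` belongs to the Boolean algebra of sets generated by the
family `S`. -/
inductive BoolComb {α : Type*} (S : Set (Set α)) : Set α → Prop
  | base (s : Set α) (hs : s ∈ S) : BoolComb S s
  | univ : BoolComb S Set.univ
  | compl (s : Set α) : BoolComb S s → BoolComb S sᶜ
  | union (s t : Set α) : BoolComb S s → BoolComb S t → BoolComb S (s ∪ t)

namespace BoolComb

variable {α : Type*} {S : Set (Set α)}

theorem empty : BoolComb S ∅ := by
  simpa using (BoolComb.univ (S := S)).compl

theorem inter {s t : Set α} (hs : BoolComb S s) (ht : BoolComb S t) : BoolComb S (s ∩ t) := by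
  simpa [Set.compl_union] using (hs.compl.union _ _ ht.compl).compl

theorem iUnion {ι : Type*} [Finite ι] {f : ι → Set α} (hf : ∀ i, BoolComb S (f i)) :
    BoolComb S (⋃ i, f i) := by
  have key : ∀ I : Set ι, I.Finite → BoolComb S (⋃ i ∈ I, f i) := by
    intro I hI
    induction I, hI using Set.Finite.induction_on with
    | empty => simpa using empty
    | insert _ _ ih => simpa only [Set.biUnion_insert] using (hf _).union _ _ ih
  simpa using key Set.univ Set.finite_univ

theorem iInter {ι : Type*} [Finite ι] {f : ι → Set α} (hf : ∀ i, BoolComb S (f i)) :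
    BoolComb S (⋂ i, f i) := by
  simpa [Set.compl_iUnion] using (iUnion fun i => (hf i).compl).compl

/-- If the members of `S` are saturated for `h` and separate its fibres, of which there are
finitely many, then every preimage under `h` is a Boolean combination of members of `S`. -/
theorem preimage_of_separates {β : Type*} [Finite β] {h : α → β}
    (hsat : ∀ s ∈ S, ∀ w w', h w = h w' → (w ∈ s ↔ w' ∈ s))
    (hsep : ∀ w w', h w ≠ h w' → ∃ s ∈ S, ¬(w ∈ s ↔ w' ∈ s)) (F : Set β) :
    BoolComb S (h ⁻¹' F) := by
  have hpair : ∀ b b', b ≠ b' → ∃ t, BoolComb S t ∧ h ⁻¹' {b} ⊆ t ∧ Disjoint t (h ⁻¹' {b'}) := by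
    intro b b' hne
    rcases (h ⁻¹' {b}).eq_empty_or_nonempty with hb | ⟨w, rfl⟩
    · exact ⟨∅, empty, hb.subset, Set.empty_disjoint _⟩
    rcases (h ⁻¹' {b'}).eq_empty_or_nonempty with hb' | ⟨w', rfl⟩
    · exact ⟨Set.univ, .univ, Set.subset_univ _, by simp [hb']⟩
    obtain ⟨s, hs, hww⟩ := hsep w w' hne
    by_cases hw : w ∈ s
    · refine ⟨s, .base s hs, fun v hv => (hsat s hs v w hv).2 hw,
        Set.disjoint_left.2 fun v hv hvw => hww ?_⟩
      exact iff_of_true hw ((hsat s hs v w' hvw).1 hv)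
    · refine ⟨sᶜ, (BoolComb.base s hs).compl, fun v hv => fun hvs => hw ((hsat s hs v w hv).1 hvs),
        Set.disjoint_left.2 fun v hv hvw => hww ?_⟩
      exact iff_of_false hw fun hw' => hv ((hsat s hs v w' hvw).2 hw')
  choose! t ht hsub hdisj using hpair
  have hfib : ∀ b, BoolComb S (h ⁻¹' {b}) := by
    intro b
    have heq : h ⁻¹' {b} = ⋂ b' : {b' // b ≠ b'}, t b b' := by
      refine Set.Subset.antisymm (Set.subset_iInter fun b' => hsub b b' b'.2) fun v hv => ?_
      by_contra hne
      exact Set.disjoint_left.1 (hdisj b (h v) (Ne.symm hne))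
        (Set.mem_iInter.1 hv ⟨h v, Ne.symm hne⟩) rfl
    rw [heq]
    exact iInter fun b' => ht b b' b'.2
  have hF : h ⁻¹' F = ⋃ b : F, h ⁻¹' {(b : β)} := by
    ext v
    simp
  rw [hF]
  exact iUnion fun b => hfib b

end BoolComb

/-- Every language recognised by a syntactic morphism of `L` is a Boolean combination of
finitely many polynomial derivatives of `L`. -/
theorem syntactic_recognised_is_boolean_combination_of_derivatives (M : SetMonad.{u})
    (Sig : Type u) (hSig : Finite Sig) (L : Set (M.T Sig))
    (hrec : M.Recognisable (M.Free Sig) L) (B : M.Alg) (h : M.T Sig → B.carrier)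
    (hsyn : M.IsSynMorphism L B h) (F : Set B.carrier) :
    ∃ P : Set (M.UPoly (M.Free Sig)), P.Finite ∧
      BoolComb {s : Set (M.T Sig) | ∃ p ∈ P, s = M.deriv p L} (h ⁻¹' F) := by
  obtain ⟨hfin, -, hsurj, hker⟩ := hsyn
  have hsep : ∀ x : {x : B.carrier × B.carrier // x.1 ≠ x.2}, ∃ p : M.UPoly (M.Free Sig),
      ∀ w w', h w = x.1.1 → h w' = x.1.2 → ¬(w ∈ M.deriv p L ↔ w' ∈ M.deriv p L) := by
    rintro ⟨⟨b, b'⟩, hne⟩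
    obtain ⟨v, rfl⟩ := hsurj b
    obtain ⟨v', rfl⟩ := hsurj b'
    obtain ⟨p, hp⟩ := not_forall.1 (mt (hker v v').2 hne)
    exact ⟨p, fun w w' hw hw' hiff =>
      hp (((hker w v).1 hw p).symm.trans (hiff.trans ((hker w' v').1 hw' p)))⟩
  choose p hp using hsep
  refine ⟨Set.range p, Set.finite_range p, BoolComb.preimage_of_separates ?_ ?_ F⟩
  · rintro _ ⟨q, -, rfl⟩ w w' hww
    exact (hker w w').1 hww q
  · intro w w' hne
    exact ⟨_, ⟨_, ⟨⟨(h w, h w'), hne⟩, rfl⟩, rfl⟩, hp ⟨(h w, h w'), hne⟩ w w' rfl rfl⟩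
end

section
/- Let A be a Boolean algebra and let B ⊆ A. Then B contains ⊥ and ⊤ and is closed under binary meets and binary joins (i.e. B is a lattice in A) if and only if B is definable by profinite implications: there exists a set I of pairs (x, y) of bounded lattice homomorphisms from A to Bool (equivalently, Boolean algebra homomorphisms A → Bool, which correspond to ultrafilters of A) such that B = {a ∈ A : for every (x, y) ∈ I, x(a) = true implies y(a) = true}. -/
/-- The bounded lattice homomorphism to `Bool` that is false exactly on a given prime ideal. -/
noncomputable def Order.Ideal.IsPrime.toBoolHom {A : Type*} [Lattice A] [BoundedOrder A]
    {J : Order.Ideal A} (hJ : J.IsPrime) : BoundedLatticeHom A Bool := by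
  classical
  exact
  { toFun := fun c => decide (c ∉ J)
    map_sup' := fun c d => by simp [imp_iff_not_or]
    map_inf' := fun c d => by
      have h : c ⊓ d ∈ J ↔ c ∈ J ∨ d ∈ J :=
        ⟨hJ.mem_or_mem, fun h => h.elim (J.lower inf_le_left) (J.lower inf_le_right)⟩
      simp [h]
    map_top' := by simpa using hJ.toIsProper.top_notMem
    map_bot' := by simp }

theorem Order.Ideal.IsPrime.toBoolHom_eq_true {A : Type*} [Lattice A] [BoundedOrder A]
    {J : Order.Ideal A} (hJ : J.IsPrime) {c : A} : hJ.toBoolHom c = true ↔ c ∉ J := by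
  classical
  exact decide_eq_true_iff

/-- A nonempty set closed under meets and avoiding `⊥` is sent to `true` by some bounded lattice
homomorphism to `Bool`. -/
theorem exists_boundedLatticeHom_bool_forall_eq_true {A : Type*} [DistribLattice A]
    [BoundedOrder A] {S : Set A} (hne : S.Nonempty) (hinf : InfClosed S) (hbot : ⊥ ∉ S) :
    ∃ f : BoundedLatticeHom A Bool, ∀ s ∈ S, f s = true := by
  have hF : Order.IsPFilter {c : A | ∃ s ∈ S, s ≤ c} := by
    refine Order.IsPFilter.of_def (hne.mono fun s hs => ⟨s, hs, le_rfl⟩) ?_ ?_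
    · rintro c ⟨s, hs, hsc⟩ d ⟨t, ht, htd⟩
      exact ⟨s ⊓ t, ⟨s ⊓ t, hinf hs ht, le_rfl⟩, inf_le_of_left_le hsc, inf_le_of_right_le htd⟩
    · rintro c d hcd ⟨s, hs, hsc⟩
      exact ⟨s, hs, hsc.trans hcd⟩
  have hdisj : Disjoint (hF.toPFilter : Set A) (Order.Ideal.principal (⊥ : A) : Set A) := by
    rw [Set.disjoint_left]
    rintro c ⟨s, hs, hsc⟩ hc
    have h : s = ⊥ := le_bot_iff.1 (hsc.trans (Order.Ideal.mem_principal.1 hc))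
    exact hbot (h ▸ hs)
  obtain ⟨J, hJ, -, hFJ⟩ := DistribLattice.prime_ideal_of_disjoint_filter_ideal hdisj
  exact ⟨hJ.toBoolHom, fun s hs =>
    hJ.toBoolHom_eq_true.2 (Set.disjoint_left.1 hFJ ⟨s, hs, le_rfl⟩)⟩

/-- A bounded sublattice of a Boolean algebra is separated from any point outside it by a pair of
homomorphisms to `Bool`. -/
theorem exists_boundedLatticeHom_bool_separating {A : Type*} [BooleanAlgebra A] {B : Set A}
    (hbot : ⊥ ∈ B) (htop : ⊤ ∈ B) (hinf : InfClosed B) (hsup : SupClosed B) {a : A}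
    (ha : a ∉ B) :
    ∃ x y : BoundedLatticeHom A Bool, (∀ b ∈ B, x b = true → y b = true) ∧
      x a = true ∧ y a = false := by
  obtain ⟨x, hx⟩ := exists_boundedLatticeHom_bool_forall_eq_true
    (S := {c | ∃ b ∈ B, b ≤ a ∧ a ⊓ bᶜ = c}) ⟨_, ⊥, hbot, bot_le, rfl⟩
    (by
      rintro _ ⟨b, hb, hba, rfl⟩ _ ⟨c, hc, hca, rfl⟩
      exact ⟨b ⊔ c, hsup hb hc, sup_le hba hca, by rw [compl_sup, inf_inf_distrib_left]⟩)
    (by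
      rintro ⟨b, hb, hba, h⟩
      rw [← sdiff_eq, sdiff_eq_bot_iff] at h
      exact ha (le_antisymm hba h ▸ hb))
  have hxa : x a = true := by
    simpa using hx _ ⟨⊥, hbot, bot_le, rfl⟩
  have hxb : ∀ b ∈ B, b ≤ a → x b = false := by
    intro b hb hba
    have h := hx _ ⟨b, hb, hba, rfl⟩
    rw [map_inf, map_compl'] at h
    simpa [hxa] using h
  obtain ⟨y, hy⟩ := exists_boundedLatticeHom_bool_forall_eq_true
    (S := {c | ∃ b ∈ B, x b = true ∧ b ⊓ aᶜ = c}) ⟨_, ⊤, htop, map_top x, rfl⟩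
    (by
      rintro _ ⟨b, hb, hxb, rfl⟩ _ ⟨c, hc, hxc, rfl⟩
      exact ⟨b ⊓ c, hinf hb hc, by simp [hxb, hxc], by rw [inf_inf_distrib_right]⟩)
    (by
      rintro ⟨b, hb, hxb', h⟩
      rw [← sdiff_eq, sdiff_eq_bot_iff] at h
      simp [hxb b hb h] at hxb')
  have hy' : ∀ b ∈ B, x b = true → y b = true ∧ y a = false := by
    intro b hb hxb
    have h := hy _ ⟨b, hb, hxb, rfl⟩
    rw [map_inf, map_compl'] at h
    simpa using h
  exact ⟨x, y, fun b hb hxb => (hy' b hb hxb).1, hxa, (hy' ⊤ htop (map_top x)).2⟩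

/-- A subset of a Boolean algebra is a bounded sublattice (contains `⊥` and `⊤`, closed
under binary meets and joins) if and only if it is definable by a set of profinite
implications, i.e. pairs of bounded lattice homomorphisms into `Bool` (equivalently,
ultrafilters / points of the Stone dual). -/
theorem lattice_iff_definable_by_profinite_implications
    {A : Type*} [BooleanAlgebra A] (B : Set A) :
    (⊥ ∈ B ∧ ⊤ ∈ B ∧ (∀ a b, a ∈ B → b ∈ B → a ⊓ b ∈ B) ∧
      (∀ a b, a ∈ B → b ∈ B → a ⊔ b ∈ B)) ↔
    ∃ I : Set (BoundedLatticeHom A Bool × BoundedLatticeHom A Bool),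
      B = {a | ∀ xy ∈ I, xy.1 a = true → xy.2 a = true} := by
  constructor
  · rintro ⟨hbot, htop, hinf, hsup⟩
    refine ⟨{xy | ∀ b ∈ B, xy.1 b = true → xy.2 b = true}, Set.Subset.antisymm ?_ ?_⟩
    · exact fun b hb xy hxy => hxy b hb
    · intro a h
      by_contra ha
      obtain ⟨x, y, hxy, hxa, hya⟩ := exists_boundedLatticeHom_bool_separating hbot htop
        (fun b hb c hc => hinf b c hb hc) (fun b hb c hc => hsup b c hb hc) ha
      have hya' : y a = true := h (x, y) hxy hxa
      simp [hya] at hya'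
  · rintro ⟨I, rfl⟩
    refine ⟨fun xy _ h => ?_, fun xy _ _ => map_top xy.2, fun a b ha hb xy hxy h => ?_,
      fun a b ha hb xy hxy h => ?_⟩
    · simp at h
    · simp only [map_inf, Bool.min_eq_and, Bool.and_eq_true] at h ⊢
      exact ⟨ha xy hxy h.1, hb xy hxy h.2⟩
    · simp only [map_sup, Bool.max_eq_or, Bool.or_eq_true] at h ⊢
      exact h.imp (ha xy hxy) (hb xy hxy)
end

section
/- Let T be a monad on the category of sets, and for each set Σ let T̄ Σ denote the set of T-morphism types over the free T-algebra T Σ, with profinite extensions h̄ : T̄ Σ → B for T-morphisms h : T Σ → B into finite T-algebras of the skeleton. Then there are unique functions T̄f : T̄Γ → T̄Σ (for each function f : Γ → Σ), η̄_Σ : Σ → T̄Σ, and μ̄_Σ : T̄ T̄ Σ → T̄ Σ such that for every T-morphism h : T Σ → A into a finite T-algebra A of the skeleton the following hold: (i) h̄ ∘ T̄f = (h ∘ T f)‾; (ii) h̄ ∘ η̄_Σ = h ∘ η_Σ, where η is the unit of T; (iii) h̄ ∘ μ̄_Σ = (mul_A)‾ ∘ T̄(h̄), where mul_A : T A → A is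 viewed as a T-morphism from the free algebra on the underlying set of A. Furthermore, equipped with these operations T̄ is a monad: T̄ is functorial, η̄ and μ̄ are natural transformations, μ̄ is associative, and μ̄_Σ ∘ η̄_{T̄Σ} = id = μ̄_Σ ∘ T̄(η̄_Σ). -/
universe u

namespace SetMonad

variable (M : SetMonad.{u})

variable {M}

theorem isHom_comp {A B C : M.Alg} {h : A.carrier → B.carrier}
    {g : B.carrier → C.carrier} (hh : M.IsHom A B h) (hg : M.IsHom B C g) :
    M.IsHom A C (g ∘ h) := by
  intro w
  show g (h (A.mul w)) = C.mul (M.map (g ∘ h) w)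
  rw [hh w, hg, M.map_comp]

theorem mapIsHom {Gam Sig : Type u} (f : Gam → Sig) :
    M.IsHom (M.Free Gam) (M.Free Sig) (M.map f) :=
  fun w => M.mult_nat f w

variable (M)

/-- The finite `T`-algebras of the chosen skeleton: algebra structures on `ULift (Fin n)`. -/
structure FinAlgOn (n : ℕ) : Type u where
  mul : M.T (ULift.{u} (Fin n)) → ULift.{u} (Fin n)
  mul_unit : ∀ a, mul (M.unit a) = a
  mul_assoc : ∀ w, mul (M.mult w) = mul (M.map mul w)

/-- The algebra corresponding to a skeleton algebra. -/
def FinAlgOn.toAlg {M : SetMonad.{u}} {n : ℕ} (B : M.FinAlgOn n) : M.Alg where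
  carrier := ULift.{u} (Fin n)
  mul := B.mul
  mul_unit := B.mul_unit
  mul_assoc := B.mul_assoc

/-- The multiplication of an algebra, viewed as a `T`-morphism from the free algebra on
its underlying set. -/
theorem mulIsHom {n : ℕ} (B : M.FinAlgOn n) :
    M.IsHom (M.Free (ULift.{u} (Fin n))) B.toAlg B.mul :=
  fun w => B.mul_assoc w

/-- A `T`-morphism type over the algebra `A`: a compatible assignment of values to all
`T`-morphisms from `A` into finite `T`-algebras of the skeleton. The set of such types
is the compactification `Ā` of `A`. -/
structure MorphType (A : M.Alg) : Type u where
  app : ∀ (n : ℕ) (B : M.FinAlgOn n) (h : A.carrier → ULift.{u} (Fin n)),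
    M.IsHom A B.toAlg h → ULift.{u} (Fin n)
  compat : ∀ (n m : ℕ) (B : M.FinAlgOn n) (C : M.FinAlgOn m)
    (h : A.carrier → ULift.{u} (Fin n)) (hh : M.IsHom A B.toAlg h)
    (g : ULift.{u} (Fin n) → ULift.{u} (Fin m)) (hg : M.IsHom B.toAlg C.toAlg g),
    app m C (g ∘ h) (isHom_comp hh hg) = g (app n B h hh)

/-- The profinite monad on objects: `T̄ Σ` is the set of morphism types over the free
algebra `T Σ`. -/
def TBar (Sig : Type u) : Type u := M.MorphType (M.Free Sig)


end SetMonad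

/-- Candidate monad operations for the profinite monad `T̄`. -/
structure TBarOps (M : SetMonad.{u}) : Type (u + 1) where
  fmap : {Gam Sig : Type u} → (Gam → Sig) → M.TBar Gam → M.TBar Sig
  unit : {Sig : Type u} → Sig → M.TBar Sig
  mult : {Sig : Type u} → M.TBar (M.TBar Sig) → M.TBar Sig

namespace TBarOps

variable {M : SetMonad.{u}}

/-- The defining diagrams of the profinite monad operations: for every `T`-morphism
`h : T Σ → A` into a finite `T`-algebra of the skeleton,
(i) `h̄ ∘ T̄f = (h ∘ T f)‾`, (ii) `h̄ ∘ η̄ = h ∘ η`, and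
(iii) `h̄ ∘ μ̄ = (mul_A)‾ ∘ T̄(h̄)`. -/
def Char (o : TBarOps M) : Prop :=
  (∀ (Gam Sig : Type u) (f : Gam → Sig) (n : ℕ) (B : M.FinAlgOn n)
      (h : M.T Sig → ULift.{u} (Fin n)) (hh : M.IsHom (M.Free Sig) B.toAlg h)
      (τ : M.TBar Gam),
      (o.fmap f τ).app n B h hh
        = τ.app n B (h ∘ M.map f) (SetMonad.isHom_comp (SetMonad.mapIsHom f) hh)) ∧
  (∀ (Sig : Type u) (n : ℕ) (B : M.FinAlgOn n)
      (h : M.T Sig → ULift.{u} (Fin n)) (hh : M.IsHom (M.Free Sig) B.toAlg h)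
      (x : Sig),
      (o.unit x).app n B h hh = h (M.unit x)) ∧
  (∀ (Sig : Type u) (n : ℕ) (B : M.FinAlgOn n)
      (h : M.T Sig → ULift.{u} (Fin n)) (hh : M.IsHom (M.Free Sig) B.toAlg h)
      (τ : M.TBar (M.TBar Sig)),
      (o.mult τ).app n B h hh
        = (o.fmap (fun σ : M.TBar Sig => σ.app n B h hh) τ).app n B B.mul
            (M.mulIsHom B))

/-- The monad laws for the profinite operations: functoriality, naturality of unit and
multiplication, associativity, and the unit laws. -/
def IsMonad (o : TBarOps M) : Prop :=
  (∀ (Sig : Type u) (τ : M.TBar Sig), o.fmap id τ = τ) ∧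
  (∀ (Gam Del Sig : Type u) (f : Gam → Del) (g : Del → Sig) (τ : M.TBar Gam),
    o.fmap (g ∘ f) τ = o.fmap g (o.fmap f τ)) ∧
  (∀ (Gam Sig : Type u) (f : Gam → Sig) (x : Gam), o.fmap f (o.unit x) = o.unit (f x)) ∧
  (∀ (Gam Sig : Type u) (f : Gam → Sig) (τ : M.TBar (M.TBar Gam)),
    o.fmap f (o.mult τ) = o.mult (o.fmap (o.fmap f) τ)) ∧
  (∀ (Sig : Type u) (τ : M.TBar Sig), o.mult (o.unit τ) = τ) ∧
  (∀ (Sig : Type u) (τ : M.TBar Sig), o.mult (o.fmap o.unit τ) = τ) ∧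
  (∀ (Sig : Type u) (τ : M.TBar (M.TBar (M.TBar Sig))),
    o.mult (o.mult τ) = o.mult (o.fmap o.mult τ))

end TBarOps

namespace SetMonad

variable {M : SetMonad.{u}}

theorem MorphType.ext {A : M.Alg} {σ τ : M.MorphType A}
    (H : ∀ n B h hh, σ.app n B h hh = τ.app n B h hh) : σ = τ := by
  cases σ
  cases τ
  congr
  funext n B h hh
  exact H n B h hh

theorem MorphType.app_congr {A : M.Alg} (τ : M.MorphType A) {n : ℕ} {B : M.FinAlgOn n}
    {h h' : A.carrier → ULift.{u} (Fin n)} (e : h = h') (hh : M.IsHom A B.toAlg h)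
    (hh' : M.IsHom A B.toAlg h') : τ.app n B h hh = τ.app n B h' hh' := by
  subst e
  rfl

/-- The `T`-morphism from the free algebra induced by a function into a finite algebra. -/
def FinAlgOn.lift {X : Type u} {n : ℕ} (B : M.FinAlgOn n) (f : X → ULift.{u} (Fin n)) :
    M.T X → ULift.{u} (Fin n) :=
  fun w => B.mul (M.map f w)

theorem FinAlgOn.isHom_lift {X : Type u} {n : ℕ} (B : M.FinAlgOn n)
    (f : X → ULift.{u} (Fin n)) : M.IsHom (M.Free X) B.toAlg (B.lift f) :=
  isHom_comp (mapIsHom f) (M.mulIsHom B)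

theorem FinAlgOn.lift_comp_map {X Y : Type u} {n : ℕ} (B : M.FinAlgOn n)
    (g : Y → ULift.{u} (Fin n)) (f : X → Y) : B.lift g ∘ M.map f = B.lift (g ∘ f) := by
  funext w
  exact congrArg B.mul (M.map_comp g f w).symm

theorem FinAlgOn.lift_unit {X : Type u} {n : ℕ} (B : M.FinAlgOn n)
    (f : X → ULift.{u} (Fin n)) (x : X) : B.lift f (M.unit x) = f x := by
  unfold FinAlgOn.lift
  rw [M.unit_nat, B.mul_unit]

theorem FinAlgOn.lift_comp_hom {X : Type u} {n m : ℕ} {B : M.FinAlgOn n} {C : M.FinAlgOn m}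
    {g : ULift.{u} (Fin n) → ULift.{u} (Fin m)} (hg : M.IsHom B.toAlg C.toAlg g)
    (f : X → ULift.{u} (Fin n)) : C.lift (g ∘ f) = g ∘ B.lift f := by
  funext w
  exact (congrArg C.mul (M.map_comp g f w)).trans (hg (M.map f w)).symm

theorem FinAlgOn.lift_hom_unit {X : Type u} {n : ℕ} {B : M.FinAlgOn n}
    {h : M.T X → ULift.{u} (Fin n)} (hh : M.IsHom (M.Free X) B.toAlg h) :
    B.lift (fun x => h (M.unit x)) = h := by
  funext w
  have e : h (M.mult (M.map M.unit w)) = B.mul (M.map h (M.map M.unit w)) :=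
    hh (M.map M.unit w)
  rw [M.mult_map_unit, ← M.map_comp] at e
  exact e.symm

/-- The profinite extension of a `T`-morphism. -/
def TBar.eval {Sig : Type u} {n : ℕ} (B : M.FinAlgOn n) (h : M.T Sig → ULift.{u} (Fin n))
    (hh : M.IsHom (M.Free Sig) B.toAlg h) (σ : M.TBar Sig) : ULift.{u} (Fin n) :=
  σ.app n B h hh

variable (M)

/-- The operations of the profinite monad. -/
def tbarOps : TBarOps M where
  fmap f τ :=
    { app := fun n B h hh => τ.app n B (h ∘ M.map f) (isHom_comp (mapIsHom f) hh)
      compat := fun n m B C h hh g hg =>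
        τ.compat n m B C (h ∘ M.map f) (isHom_comp (mapIsHom f) hh) g hg }
  unit x :=
    { app := fun _ _ h _ => h (M.unit x)
      compat := fun _ _ _ _ _ _ _ _ => rfl }
  mult τ :=
    { app := fun n B h hh => τ.app n B (B.lift (TBar.eval B h hh)) (B.isHom_lift _)
      compat := fun n m B C h hh g hg => by
        have e : TBar.eval C (g ∘ h) (isHom_comp hh hg) = g ∘ TBar.eval B h hh :=
          funext fun σ => σ.compat n m B C h hh g hg
        rw [← τ.compat n m B C _ (B.isHom_lift _) g hg]
        exact τ.app_congr ((congrArg C.lift e).trans (FinAlgOn.lift_comp_hom hg _)) _ _ }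

theorem tbarOps_char : (tbarOps M).Char :=
  ⟨fun _ _ _ _ _ _ _ _ => rfl, fun _ _ _ _ _ _ => rfl, fun _ _ _ _ _ _ => rfl⟩

theorem tbarOps_isMonad : (tbarOps M).IsMonad := by
  refine ⟨fun Sig τ => ?_, fun Gam Del Sig f g τ => ?_, fun Gam Sig f x => ?_,
    fun Gam Sig f τ => ?_, fun Sig τ => ?_, fun Sig τ => ?_, fun Sig τ => ?_⟩ <;>
    refine MorphType.ext fun n B h hh => ?_
  · exact τ.app_congr (funext fun w => congrArg h (M.map_id w)) _ _
  · exact τ.app_congr (funext fun w => congrArg h (M.map_comp g f w)) _ _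
  · exact congrArg h (M.unit_nat f x)
  · exact τ.app_congr (B.lift_comp_map (TBar.eval B h hh) ((tbarOps M).fmap f)).symm _ _
  · exact B.lift_unit (TBar.eval B h hh) τ
  · exact τ.app_congr ((B.lift_comp_map (TBar.eval B h hh) (tbarOps M).unit).trans
      (FinAlgOn.lift_hom_unit hh)) _ _
  · exact τ.app_congr (B.lift_comp_map (TBar.eval B h hh) (tbarOps M).mult).symm _ _

variable {M}

theorem _root_.TBarOps.Char.eq {o o' : TBarOps M} (H : o.Char) (H' : o'.Char) : o = o' := by
  obtain ⟨hf, hu, hm⟩ := H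
  obtain ⟨hf', hu', hm'⟩ := H'
  have ef : @o.fmap = @o'.fmap := by
    funext Gam Sig f τ
    exact MorphType.ext fun n B h hh => (hf _ _ f n B h hh τ).trans (hf' _ _ f n B h hh τ).symm
  have eu : @o.unit = @o'.unit := by
    funext Sig x
    exact MorphType.ext fun n B h hh => (hu _ n B h hh x).trans (hu' _ n B h hh x).symm
  have em : @o.mult = @o'.mult := by
    funext Sig τ
    refine MorphType.ext fun n B h hh => ?_
    rw [← ef] at hm'
    exact (hm _ n B h hh τ).trans (hm' _ n B h hh τ).symm
  cases o
  cases o'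
  cases ef
  cases eu
  cases em
  rfl

end SetMonad

/-- **The profinite monad.** There are unique operations `T̄f`, `η̄` and `μ̄` satisfying
the defining diagrams with respect to profinite extensions, and equipped with them `T̄`
is a monad. -/
theorem profinite_monad_exists_unique (M : SetMonad.{u}) :
    ∃ o : TBarOps M, o.Char ∧ o.IsMonad ∧ ∀ o' : TBarOps M, o'.Char → o' = o :=
  ⟨M.tbarOps, M.tbarOps_char, M.tbarOps_isMonad, fun _ H => H.eq M.tbarOps_char⟩
end

section
/- Let T be a monad on the category of sets, let A be a T-algebra, and equip its compactification Ā with the topology generated by the sets h̄⁻¹({b}), for h : A → B a T-morphism into a finite T-algebra of the skeleton and b ∈ B. Then for every T-morphism h : A → B into a finite T-algebra of the skeleton and every F ⊆ B, the closure in Ā of ι_A(h⁻¹(F)) equals h̄⁻¹(F), where ι_A : A → Ā is the map a ↦ (h' ↦ h'(a)). -/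
universe u

namespace SetMonad

variable (M : SetMonad.{u})

variable {M}

variable (M)

/-- The topology on the compactification `Ā`, generated by the base sets
`h̄⁻¹({b})` for profinite extensions of morphisms into finite skeleton algebras. -/
def typeTopology (A : M.Alg) : TopologicalSpace (M.MorphType A) :=
  TopologicalSpace.generateFrom
    {S | ∃ (n : ℕ) (B : M.FinAlgOn n) (h : A.carrier → ULift.{u} (Fin n))
        (hh : M.IsHom A B.toAlg h) (b : ULift.{u} (Fin n)),
        S = {τ : M.MorphType A | τ.app n B h hh = b}}

/-- The canonical map `ι_A : A → Ā` sending `a` to the type `h ↦ h(a)`. -/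
def iota (A : M.Alg) (a : A.carrier) : M.MorphType A where
  app := fun _ _ h _ => h a
  compat := fun _ _ _ _ _ _ _ _ => rfl

end SetMonad

namespace SetMonad

variable {M : SetMonad.{u}}

/-- Finitely many morphisms from `A` into finite skeleton algebras factor through a single
surjective morphism onto a finite skeleton algebra. -/
theorem exists_surjective_isHom_factor {A : M.Alg} {ι : Type*} [Finite ι] (k : ι → ℕ)
    (B : ∀ i, M.FinAlgOn (k i)) (h : ∀ i, A.carrier → ULift.{u} (Fin (k i)))
    (hh : ∀ i, M.IsHom A (B i).toAlg (h i)) :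
    ∃ (m : ℕ) (C : M.FinAlgOn m) (j : A.carrier → ULift.{u} (Fin m))
      (p : ∀ i, ULift.{u} (Fin m) → ULift.{u} (Fin (k i))),
      Function.Surjective j ∧ M.IsHom A C.toAlg j ∧
        (∀ i, M.IsHom C.toAlg (B i).toAlg (p i)) ∧ ∀ i, p i ∘ j = h i := by
  let f : A.carrier → ∀ i, ULift.{u} (Fin (k i)) := fun a i => h i a
  obtain ⟨m, ⟨e⟩⟩ := Finite.exists_equiv_fin (Set.range f)
  let j : A.carrier → ULift.{u} (Fin m) := fun a => ⟨e ⟨f a, a, rfl⟩⟩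
  let p : ∀ i, ULift.{u} (Fin m) → ULift.{u} (Fin (k i)) := fun i q => (e.symm q.down).1 i
  have hpj : ∀ i, p i ∘ j = h i := fun i => by
    funext a
    simp [p, j, f]
  have hinj : ∀ q q', (∀ i, p i q = p i q') → q = q' := fun q q' hq =>
    ULift.down_injective (e.symm.injective (Subtype.ext (funext hq)))
  have hj : Function.Surjective j := by
    rintro ⟨q⟩
    obtain ⟨a, ha⟩ := (e.symm q).2
    refine ⟨a, congrArg ULift.up ?_⟩
    rw [← e.apply_symm_apply q]
    exact congrArg e (Subtype.ext ha)
  obtain ⟨s, hs⟩ := hj.hasRightInverse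
  let mulC : M.T (ULift.{u} (Fin m)) → ULift.{u} (Fin m) := fun w => j (A.mul (M.map s w))
  have hp : ∀ i w, p i (mulC w) = (B i).mul (M.map (p i) w) := fun i w => by
    have hps : h i ∘ s = p i := by
      funext q
      rw [← hpj i]
      exact congrArg (p i) (hs q)
    calc p i (mulC w) = h i (A.mul (M.map s w)) := congrFun (hpj i) _
      _ = (B i).mul (M.map (h i) (M.map s w)) := hh i _
      _ = (B i).mul (M.map (p i) w) := by rw [← hps, M.map_comp]
  have hpcomp : ∀ i, p i ∘ mulC = (B i).mul ∘ M.map (p i) := fun i => funext (hp i)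
  let C : M.FinAlgOn m :=
    { mul := mulC
      mul_unit := fun q => hinj _ _ fun i => by rw [hp, M.unit_nat, (B i).mul_unit]
      mul_assoc := fun w => hinj _ _ fun i => by
        rw [hp, hp, M.mult_nat, (B i).mul_assoc, ← M.map_comp, ← M.map_comp, hpcomp] }
  refine ⟨m, C, j, p, hj, fun w => hinj _ _ fun i => ?_, hp, hpj⟩
  calc p i (j (A.mul w)) = h i (A.mul w) := congrFun (hpj i) _
    _ = (B i).mul (M.map (h i) w) := hh i w
    _ = p i (mulC (M.map j w)) := by rw [hp, ← M.map_comp, hpj]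

/-- On finitely many morphisms, every morphism type agrees with an element of the algebra. -/
theorem MorphType.exists_forall_app_eq {A : M.Alg} (τ : M.MorphType A) {ι : Type*} [Finite ι]
    (k : ι → ℕ) (B : ∀ i, M.FinAlgOn (k i)) (h : ∀ i, A.carrier → ULift.{u} (Fin (k i)))
    (hh : ∀ i, M.IsHom A (B i).toAlg (h i)) :
    ∃ a, ∀ i, τ.app (k i) (B i) (h i) (hh i) = h i a := by
  obtain ⟨m, C, j, p, hj, hjhom, hp, hpj⟩ := exists_surjective_isHom_factor k B h hh
  obtain ⟨a, ha⟩ := hj (τ.app m C j hjhom)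
  refine ⟨a, fun i => ?_⟩
  have key := τ.compat m (k i) C (B i) j hjhom (p i) (hp i)
  simp only [hpj i] at key
  rw [key, ← ha]
  exact congrFun (hpj i) a

theorem isOpen_app_eq {A : M.Alg} {n : ℕ} (B : M.FinAlgOn n)
    (h : A.carrier → ULift.{u} (Fin n)) (hh : M.IsHom A B.toAlg h) (b : ULift.{u} (Fin n)) :
    @IsOpen _ (M.typeTopology A) {τ : M.MorphType A | τ.app n B h hh = b} :=
  TopologicalSpace.isOpen_generateFrom_of_mem ⟨n, B, h, hh, b, rfl⟩

theorem isClosed_app_mem {A : M.Alg} {n : ℕ} (B : M.FinAlgOn n)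
    (h : A.carrier → ULift.{u} (Fin n)) (hh : M.IsHom A B.toAlg h)
    (F : Set (ULift.{u} (Fin n))) :
    @IsClosed _ (M.typeTopology A) {τ : M.MorphType A | τ.app n B h hh ∈ F} := by
  let _ := M.typeTopology A
  have hc : {τ : M.MorphType A | τ.app n B h hh ∈ F}ᶜ =
      ⋃ b ∈ Fᶜ, {τ : M.MorphType A | τ.app n B h hh = b} := by
    ext τ
    simp
  rw [← isOpen_compl_iff, hc]
  exact isOpen_biUnion fun b _ => isOpen_app_eq B h hh b

end SetMonad

/-- In the compactification `Ā` of a `T`-algebra `A`, the closure of the image under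
`ι_A` of `h⁻¹(F)` equals `h̄⁻¹(F)`, for every `T`-morphism `h` into a finite skeleton
algebra and every `F`. -/
theorem closure_of_recognisable (M : SetMonad.{u}) (A : M.Alg) (n : ℕ)
    (B : M.FinAlgOn n) (h : A.carrier → ULift.{u} (Fin n)) (hh : M.IsHom A B.toAlg h)
    (F : Set (ULift.{u} (Fin n))) :
    @closure (M.MorphType A) (M.typeTopology A) (M.iota A '' (h ⁻¹' F))
      = {τ : M.MorphType A | τ.app n B h hh ∈ F} := by
  let _ := M.typeTopology A
  apply subset_antisymm
  · refine closure_minimal ?_ (SetMonad.isClosed_app_mem B h hh F)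
    rintro _ ⟨a, ha, rfl⟩
    exact ha
  · intro τ hτ
    rw [(TopologicalSpace.isTopologicalBasis_of_subbasis
      (t := M.typeTopology A) rfl).mem_closure_iff]
    rintro _ ⟨S, ⟨hSfin, hS⟩, rfl⟩ hτS
    choose k C g hg b hb using fun s : S => hS s.2
    have : Finite S := hSfin
    obtain ⟨a, ha⟩ := τ.exists_forall_app_eq (ι := Option S)
      (fun i => i.elim n k) (fun i => i.rec B C) (fun i => i.rec h g) (fun i => i.rec hh hg)
    refine ⟨M.iota A a, fun s hs => ?_, a, ?_, rfl⟩
    · have hτs : τ ∈ s := hτS s hs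
      have hsb : s = _ := hb ⟨s, hs⟩
      rw [hsb] at hτs ⊢
      exact (ha (some ⟨s, hs⟩)).symm.trans hτs
    · have han : τ.app n B h hh = h a := ha none
      exact Set.mem_preimage.2 (Set.mem_of_eq_of_mem han.symm hτ)
end

section
/- (Ramsey factorisation for finite monoids) Let M be a finite monoid and let a : ℕ → M be a sequence. Then there exist an idempotent e ∈ M (e * e = e) and a strictly increasing function k : ℕ → ℕ such that for all i < j, the product a(k i) * a(k i + 1) * ⋯ * a(k j − 1) (the product of a over the interval [k i, k j)) equals e. -/
/-- The (ordered) product of `a` over the interval `[m, n)`. -/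
def intervalProd {M : Type*} [Monoid M] (a : ℕ → M) (m n : ℕ) : M :=
  ((List.range' m (n - m)).map a).prod

theorem Ultrafilter.exists_eventually_eq {α β : Type*} [Finite β] (U : Ultrafilter α)
    (f : α → β) : ∃ b, ∀ᶠ x in (U : Filter α), f x = b := by
  obtain ⟨b, hb⟩ := (U.map f).eq_pure_of_finite
  refine ⟨b, ?_⟩
  have h : {b} ∈ U.map f := by simp [hb]
  exact h

/-- Ramsey's theorem for pairs of natural numbers: every finite colouring of the pairs has an
infinite monochromatic set, given by its increasing enumeration. -/
theorem exists_strictMono_monochromatic {C : Type*} [Finite C] (f : ℕ → ℕ → C) :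
    ∃ (c : C) (k : ℕ → ℕ), StrictMono k ∧ ∀ i j, i < j → f (k i) (k j) = c := by
  let U := Filter.hyperfilter ℕ
  choose g hg using fun m => U.exists_eventually_eq (f m)
  obtain ⟨c, hc⟩ := U.exists_eventually_eq g
  have hgt (m : ℕ) : ∀ᶠ n in (U : Filter ℕ), m < n :=
    Nat.hyperfilter_le_atTop (Filter.eventually_gt_atTop m)
  obtain ⟨k, -, hk⟩ := exists_seq_of_forall_finset_exists (fun m => g m = c)
    (fun m n => m < n ∧ f m n = c) fun s hs => by
      refine (hc.and ((Filter.eventually_all_finset s).2 fun m hm => ?_)).exists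
      filter_upwards [hgt m, hg m] with n hmn hfn
      exact ⟨hmn, hfn.trans (hs m hm)⟩
  exact ⟨c, k, fun i j hij => (hk i j hij).1, fun i j hij => (hk i j hij).2⟩

theorem intervalProd_mul_intervalProd {M : Type*} [Monoid M] (a : ℕ → M) {l m n : ℕ}
    (hlm : l ≤ m) (hmn : m ≤ n) :
    intervalProd a l m * intervalProd a m n = intervalProd a l n := by
  obtain ⟨p, rfl⟩ := Nat.exists_eq_add_of_le hlm
  obtain ⟨q, rfl⟩ := Nat.exists_eq_add_of_le hmn
  have hsub : l + p + q - l = p + q := by lia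
  simp only [intervalProd, Nat.add_sub_cancel_left, hsub]
  rw [← List.range'_append_1, List.map_append, List.prod_append]

/-- **Ramsey factorisation for finite monoids.** For every sequence in a finite monoid
there is an idempotent `e` and a strictly increasing sequence of cut points such that
the product over every interval between two cut points equals `e`. -/
theorem ramsey_factorisation {M : Type*} [Monoid M] [Fintype M] (a : ℕ → M) :
    ∃ (e : M) (k : ℕ → ℕ), e * e = e ∧ StrictMono k ∧
      ∀ i j : ℕ, i < j → intervalProd a (k i) (k j) = e := by
  obtain ⟨e, k, hk, he⟩ := exists_strictMono_monochromatic (intervalProd a)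
  refine ⟨e, k, ?_, hk, he⟩
  have h := intervalProd_mul_intervalProd a (hk.monotone (Nat.zero_le 1))
    (hk.monotone (Nat.le_succ 1))
  rwa [he 0 1 (by lia), he 1 2 (by lia), he 0 2 (by lia)] at h
end
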